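/- arXiv:2504.02207 — 11 statements merged into one kernel-verified Lean document; each statement's English description precedes it below -/
import Mathlib

section
/- Let P and Q be probability distributions on a countable set S with Q(x) > 0 whenever P(x) > 0. Then, with values taken in [0,∞], the Chi-square distance satisfies the variational representation χ²(P,Q) = sup { (E_P[g] − E_Q[g])² / Var_Q(g) : g : S → ℝ with Σ_x Q(x)·g(x)² < ∞, Σ_x P(x)·|g(x)| < ∞, and Var_Q(g) > 0 }, where E_P[g] = Σ_x P(x)g(x), E_Q[g] = Σ_x Q(x)g(x) and Var_Q(g) = Σ_x Q(x)g(x)² − (Σ_x Q(x)g(x))², and the supremum over the empty family is 0. -/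
open Filter Topology in
/-- Cauchy–Schwarz for unconditional sums: if `r x ^ 2 = f x * g x` pointwise, then
`(∑ r) ^ 2 ≤ (∑ f) * (∑ g)`. -/
theorem HasSum.sq_le_mul_of_sq_eq_mul {ι : Type*} {r f g : ι → ℝ} {a b c : ℝ}
    (hr : HasSum r a) (hf : HasSum f b) (hg : HasSum g c)
    (hf0 : ∀ i, 0 ≤ f i) (hg0 : ∀ i, 0 ≤ g i) (h : ∀ i, r i ^ 2 = f i * g i) :
    a ^ 2 ≤ b * c :=
  le_of_tendsto_of_tendsto' (Tendsto.pow hr 2) (Tendsto.mul hf hg) fun s =>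
    Finset.sum_sq_le_sum_mul_sum_of_sq_le_mul s (fun i _ => hf0 i) (fun i _ => hg0 i)
      (fun i _ => (h i).le)

/-- A real-valued function with sum `1` (in the sense of `tsum`) is summable. -/
theorem summable_of_tsum_eq_one {ι : Type*} {f : ι → ℝ} (h : ∑' i, f i = 1) : Summable f := by
  by_contra hf
  simp [tsum_eq_zero_of_not_summable hf] at h

/-- A square-integrable function is integrable with respect to a finite discrete measure. -/
theorem summable_mul_of_summable_mul_sq {ι : Type*} {q g : ι → ℝ} (hq0 : ∀ i, 0 ≤ q i)
    (hq : Summable q) (hg : Summable fun i => q i * g i ^ 2) : Summable fun i => q i * g i := by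
  refine Summable.of_norm_bounded (hq.add hg) fun i => ?_
  rw [Real.norm_eq_abs, abs_mul, abs_of_nonneg (hq0 i)]
  have h : |g i| ≤ 1 + g i ^ 2 := by
    rw [← sq_abs]
    nlinarith [sq_nonneg (|g i| - 1), abs_nonneg (g i)]
  nlinarith [mul_le_mul_of_nonneg_left h (hq0 i)]

/-- The variance as the sum of the squared deviations from the mean. -/
theorem hasSum_mul_sub_mean_sq {ι : Type*} {q g : ι → ℝ} (hq0 : ∀ i, 0 ≤ q i)
    (hq : ∑' i, q i = 1) (hg : Summable fun i => q i * g i ^ 2) :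
    HasSum (fun i => q i * (g i - ∑' j, q j * g j) ^ 2)
      ((∑' i, q i * g i ^ 2) - (∑' i, q i * g i) ^ 2) := by
  have hqs := summable_of_tsum_eq_one hq
  have hqg := summable_mul_of_summable_mul_sq hq0 hqs hg
  set m := ∑' j, q j * g j with hm
  have h1 : HasSum q 1 := hq ▸ hqs.hasSum
  convert (hg.hasSum.sub (hqg.hasSum.mul_left (2 * m))).add (h1.mul_left (m ^ 2)) using 1
  · rfl
  · funext i
    ring
  · rw [← hm]
    ring

/-- A difference of means is unchanged when the function is shifted by a constant. -/
theorem hasSum_sub_mul_sub_const {ι : Type*} {p q g : ι → ℝ} (hp : ∑' i, p i = 1)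
    (hq : ∑' i, q i = 1) (hpg : Summable fun i => p i * g i)
    (hqg : Summable fun i => q i * g i) (m : ℝ) :
    HasSum (fun i => (p i - q i) * (g i - m)) ((∑' i, p i * g i) - ∑' i, q i * g i) := by
  have h1 : HasSum p 1 := hp ▸ (summable_of_tsum_eq_one hp).hasSum
  have h2 : HasSum q 1 := hq ▸ (summable_of_tsum_eq_one hq).hasSum
  convert (hpg.hasSum.sub hqg.hasSum).sub ((h1.sub h2).mul_left m) using 1
  · rfl
  · funext i
    ring
  · ring


/-- Variational representation of the Chi-square distance (Proposition 1 of the paper).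
`χ²(P,Q)`, as a value in `[0,∞]`, equals the supremum of
`(E_P[g] − E_Q[g])² / Var_Q(g)` over all `g` with `Σ Q·g² < ∞`, `Σ P·|g| < ∞` and
`Var_Q(g) > 0` (the supremum of the empty family being `0`). -/
theorem chi_square_variational_representation
    {S : Type*} [Countable S]
    (P Q : S → ℝ)
    (hP0 : ∀ x, 0 ≤ P x) (hP1 : ∑' x, P x = 1)
    (hQ0 : ∀ x, 0 ≤ Q x) (hQ1 : ∑' x, Q x = 1)
    (hac : ∀ x, 0 < P x → 0 < Q x) :
    (∑' x, ENNReal.ofReal ((P x - Q x) ^ 2 / Q x))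
      = ⨆ (g : S → ℝ) (_ : Summable fun x => Q x * g x ^ 2)
          (_ : Summable fun x => P x * |g x|)
          (_ : 0 < (∑' x, Q x * g x ^ 2) - (∑' x, Q x * g x) ^ 2),
          ENNReal.ofReal (((∑' x, P x * g x) - ∑' x, Q x * g x) ^ 2
            / ((∑' x, Q x * g x ^ 2) - (∑' x, Q x * g x) ^ 2)) := by
  have hzero : ∀ x, Q x = 0 → P x = 0 := fun x hx =>
    le_antisymm (not_lt.1 fun h => (hac x h).ne' hx) (hP0 x)
  have hchi0 : ∀ x, 0 ≤ (P x - Q x) ^ 2 / Q x := fun x => div_nonneg (sq_nonneg _) (hQ0 x)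
  have hQs := summable_of_tsum_eq_one hQ1
  apply le_antisymm
  · rw [ENNReal.tsum_eq_iSup_sum]
    refine iSup_le fun F => ?_
    rw [← ENNReal.ofReal_sum_of_nonneg fun x _ => hchi0 x]
    set T := ∑ x ∈ F, (P x - Q x) ^ 2 / Q x
    have hTnonneg : 0 ≤ T := Finset.sum_nonneg fun x _ => hchi0 x
    rcases hTnonneg.eq_or_lt with hT0 | hT0
    · simp [← hT0]
    classical
    let g : S → ℝ := fun x => if x ∈ F then (P x - Q x) / Q x else 0
    have hgF : ∀ x ∉ F, g x = 0 := fun x hx => if_neg hx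
    have hg2 : HasSum (fun x => Q x * g x ^ 2) T := by
      have h : ∑ x ∈ F, Q x * g x ^ 2 = T := by
        refine Finset.sum_congr rfl fun x hx => ?_
        simp only [g, if_pos hx]
        rcases eq_or_ne (Q x) 0 with h0 | h0
        · simp [h0]
        · field_simp
      exact h ▸ hasSum_sum_of_ne_finset_zero fun x hx => by simp [hgF x hx]
    have hPg : HasSum (fun x => P x * g x) (∑ x ∈ F, P x * g x) :=
      hasSum_sum_of_ne_finset_zero fun x hx => by simp [hgF x hx]
    have hQg : HasSum (fun x => Q x * g x) (∑ x ∈ F, Q x * g x) :=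
      hasSum_sum_of_ne_finset_zero fun x hx => by simp [hgF x hx]
    have hPabs : Summable fun x => P x * |g x| :=
      summable_of_ne_finset_zero (s := F) fun x hx => by simp [hgF x hx]
    have hdiff : (∑' x, P x * g x) - ∑' x, Q x * g x = T := by
      rw [hPg.tsum_eq, hQg.tsum_eq, ← Finset.sum_sub_distrib]
      refine Finset.sum_congr rfl fun x hx => ?_
      simp only [g, if_pos hx]
      ring
    have hV := hasSum_mul_sub_mean_sq hQ0 hQ1 hg2.summable
    have hV0 : ∀ x, 0 ≤ Q x * (g x - ∑' y, Q y * g y) ^ 2 := fun x =>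
      mul_nonneg (hQ0 x) (sq_nonneg _)
    have hVpos : 0 < (∑' x, Q x * g x ^ 2) - (∑' x, Q x * g x) ^ 2 := by
      refine (hV.nonneg hV0).lt_of_ne fun h => hT0.ne' ?_
      rw [← h, hasSum_zero_iff_of_nonneg hV0] at hV
      have hd := hasSum_sub_mul_sub_const hP1 hQ1 hPg.summable hQg.summable (∑' y, Q y * g y)
      rw [hdiff] at hd
      refine hd.unique ?_
      convert hasSum_zero using 2 with x
      rcases mul_eq_zero.1 (congrFun hV x) with h0 | h0
      · simp [h0, hzero x h0]
      · simp [pow_eq_zero_iff two_ne_zero |>.1 h0]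
    refine le_trans ?_ (le_iSup_of_le g <| le_iSup_of_le hg2.summable <|
      le_iSup_of_le hPabs <| le_iSup_of_le hVpos le_rfl)
    apply ENNReal.ofReal_le_ofReal
    rw [le_div_iff₀ hVpos, hdiff, hg2.tsum_eq]
    nlinarith [mul_nonneg hT0.le (sq_nonneg (∑' x, Q x * g x))]
  · refine iSup_le fun g => iSup_le fun hg2 => iSup_le fun hPabs => iSup_le fun hVpos => ?_
    by_cases htop : ∑' x, ENNReal.ofReal ((P x - Q x) ^ 2 / Q x) = ⊤
    · rw [htop]
      exact le_top
    have hchi : Summable fun x => (P x - Q x) ^ 2 / Q x := by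
      simpa only [ENNReal.toReal_ofReal (hchi0 _)] using ENNReal.summable_toReal htop
    rw [← ENNReal.ofReal_tsum_of_nonneg hchi0 hchi]
    apply ENNReal.ofReal_le_ofReal
    rw [div_le_iff₀ hVpos]
    have hPg : Summable fun x => P x * g x :=
      Summable.of_norm_bounded hPabs fun x => by
        rw [Real.norm_eq_abs, abs_mul, abs_of_nonneg (hP0 x)]
    have hQg := summable_mul_of_summable_mul_sq hQ0 hQs hg2
    refine (hasSum_sub_mul_sub_const hP1 hQ1 hPg hQg (∑' y, Q y * g y)).sq_le_mul_of_sq_eq_mul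
      hchi.hasSum (hasSum_mul_sub_mean_sq hQ0 hQ1 hg2) hchi0
      (fun x => mul_nonneg (hQ0 x) (sq_nonneg _)) fun x => ?_
    rcases eq_or_ne (Q x) 0 with h0 | h0
    · simp [h0, hzero x h0]
    · field_simp
end

section
/- Let P and Q be probability distributions on ℕ, let θ > 0 be a real number, and assume Σ_x Q(x)·e^{2θx} < ∞ and χ²(P,Q) < ∞. Then Σ_x P(x)·e^{θx} < ∞ and |Σ_x P(x)·e^{θx} − Σ_x Q(x)·e^{θx}| ≤ χ(P,Q) · √(Σ_x Q(x)·e^{2θx} − (Σ_x Q(x)·e^{θx})²). -/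
/-- The Cauchy-Schwarz inequality for square-summable real families. -/
theorem summable_mul_and_abs_tsum_mul_le {ι : Type*} {a b : ι → ℝ}
    (ha : Summable fun i => a i ^ 2) (hb : Summable fun i => b i ^ 2) :
    (Summable fun i => a i * b i) ∧
      |∑' i, a i * b i| ≤ Real.sqrt (∑' i, a i ^ 2) * Real.sqrt (∑' i, b i ^ 2) := by
  have hab : Summable fun i => a i * b i := by
    refine Summable.of_norm_bounded (ha.add hb) fun i => ?_
    rw [Real.norm_eq_abs, abs_le]
    constructor <;> nlinarith [sq_nonneg (a i + b i), sq_nonneg (a i - b i),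
      sq_nonneg (a i), sq_nonneg (b i)]
  refine ⟨hab, ?_⟩
  have hquad : ∀ t : ℝ,
      0 ≤ (∑' i, a i ^ 2) * (t * t) + (2 * ∑' i, a i * b i) * t + ∑' i, b i ^ 2 := by
    intro t
    have hsum : HasSum (fun i => (a i * t + b i) ^ 2)
        ((∑' i, a i ^ 2) * (t * t) + (2 * ∑' i, a i * b i) * t + ∑' i, b i ^ 2) := by
      convert ((ha.hasSum.mul_right (t * t)).add
        ((hab.hasSum.mul_left 2).mul_right t)).add hb.hasSum using 1
      · rfl
      · funext i
        ring
    exact hsum.nonneg fun i => sq_nonneg _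
  have hdisc := discrim_le_zero hquad
  rw [discrim] at hdisc
  rw [← Real.sqrt_mul (tsum_nonneg fun i => sq_nonneg (a i))]
  apply Real.abs_le_sqrt
  linarith

/-- MGF comparison from the Chi-square distance (Corollary 2 of the paper):
if `Σ Q(x)·e^{2θx} < ∞` and `χ²(P,Q) < ∞` then the MGF of `P` at `θ` exists and
`|E_P[e^{θX}] − E_Q[e^{θX}]| ≤ χ(P,Q)·√(Var_Q(e^{θX}))`. -/
theorem mgf_bound_from_chi_square
    (P Q : ℕ → ℝ) (θ : ℝ) (hθ : 0 < θ)
    (hP0 : ∀ x, 0 ≤ P x) (hP1 : ∑' x, P x = 1)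
    (hQ0 : ∀ x, 0 ≤ Q x) (hQ1 : ∑' x, Q x = 1)
    (hac : ∀ x, 0 < P x → 0 < Q x)
    (hmgf : Summable fun x => Q x * Real.exp (2 * θ * x))
    (hchi : Summable fun x => (P x - Q x) ^ 2 / Q x) :
    (Summable fun x => P x * Real.exp (θ * x)) ∧
      |(∑' x, P x * Real.exp (θ * x)) - ∑' x, Q x * Real.exp (θ * x)|
        ≤ Real.sqrt (∑' x, (P x - Q x) ^ 2 / Q x)
            * Real.sqrt ((∑' x, Q x * Real.exp (2 * θ * x))
                - (∑' x, Q x * Real.exp (θ * x)) ^ 2) := by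
  have hP : Summable P := by
    by_contra h
    simp [tsum_eq_zero_of_not_summable h] at hP1
  have hQ : Summable Q := by
    by_contra h
    simp [tsum_eq_zero_of_not_summable h] at hQ1
  have hexp : ∀ x : ℕ, Real.exp (2 * θ * x) = Real.exp (θ * x) ^ 2 := by
    intro x
    rw [← Real.exp_nat_mul]
    congr 1
    push_cast
    ring
  simp only [hexp] at hmgf ⊢
  have hQf : Summable fun x : ℕ => Q x * Real.exp (θ * x) := by
    refine Summable.of_nonneg_of_le
      (fun x => mul_nonneg (hQ0 x) (Real.exp_pos _).le) (fun x => ?_) (hQ.add hmgf)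
    nlinarith [mul_nonneg (hQ0 x) (sq_nonneg (Real.exp (θ * x) - 1)),
      mul_nonneg (hQ0 x) (Real.exp_pos (θ * x)).le]
  set m := ∑' x : ℕ, Q x * Real.exp (θ * x) with hm
  have ha : ∀ x, ((P x - Q x) / Real.sqrt (Q x)) ^ 2 = (P x - Q x) ^ 2 / Q x := by
    intro x
    rw [div_pow, Real.sq_sqrt (hQ0 x)]
  have hb : ∀ x : ℕ, (Real.sqrt (Q x) * (Real.exp (θ * x) - m)) ^ 2
      = Q x * (Real.exp (θ * x) - m) ^ 2 := by
    intro x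
    rw [mul_pow, Real.sq_sqrt (hQ0 x)]
  have hab : ∀ x : ℕ, (P x - Q x) / Real.sqrt (Q x) * (Real.sqrt (Q x) * (Real.exp (θ * x) - m))
      = (P x - Q x) * (Real.exp (θ * x) - m) := by
    intro x
    rcases (hQ0 x).eq_or_lt with h | h
    · have hPx : P x = 0 :=
        le_antisymm (not_lt.mp fun hp => (hac x hp).ne h) (hP0 x)
      simp [hPx, ← h]
    · have := (Real.sqrt_pos.mpr h).ne'
      field_simp
  have hvar : HasSum (fun x : ℕ => Q x * (Real.exp (θ * x) - m) ^ 2)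
      ((∑' x : ℕ, Q x * Real.exp (θ * x) ^ 2) - m ^ 2) := by
    convert (hmgf.hasSum.sub (hQf.hasSum.mul_left (2 * m))).add (hQ.hasSum.mul_left (m ^ 2)) using 1
    · rfl
    · funext x
      ring
    · rw [hQ1, ← hm]
      ring
  obtain ⟨hs, hle⟩ := summable_mul_and_abs_tsum_mul_le
    (a := fun x => (P x - Q x) / Real.sqrt (Q x))
    (b := fun x : ℕ => Real.sqrt (Q x) * (Real.exp (θ * x) - m))
    (by simpa only [ha] using hchi) (by simpa only [hb] using hvar.summable)
  simp only [ha, hb, hab, hvar.tsum_eq] at hs hle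
  have hPf : HasSum (fun x : ℕ => P x * Real.exp (θ * x))
      ((∑' x : ℕ, (P x - Q x) * (Real.exp (θ * x) - m)) + m) := by
    convert (hs.hasSum.add hQf.hasSum).add ((hP.hasSum.sub hQ.hasSum).mul_left m) using 1
    · funext x
      ring
    · rw [hP1, hQ1, ← hm]
      ring
  refine ⟨hPf.summable, ?_⟩
  rwa [hPf.tsum_eq, add_sub_cancel_right]
end

section
/- There exist positive constants Δ₁ and Δ₂ such that the following holds. Let α ∈ [1/2, 1), let n ≥ 110 be an integer, let λ = n − n^{1−α}, let K = {⌊2λ⌋ − n, …, n−1}, and let ν_n be the stationary distribution of the M/M/n queue with arrival rate λ and unit service rate. Define b : ℕ → ℝ by b(n−1) = n^{1−α}·(1 + 1/(4·(n^α − 1))), b(q) = (n^{1−2α}/(1 − n^{−α}))·e^{n^{1−2α}/(1 − n^{−α})} for q ∈ K ∖ {n−1}, and b(q) = 0 for q ∉ K, and set τ(q) = b(q)·ν_n(q)/Σ_{p∈K} b(p)·ν_n(p). Then for every f : ℕ → ℝ with Σ_q ν_n(q)·f(q)² < ∞: Σ_q τ(q)·(f(q) − Σ_p τ(p)·f(p))²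 ≤ ((Δ₁·n^{2−4α} + Δ₂·n^{3−6α})/ν_n(K))·E(f,f), where ν_n(K) = Σ_{q∈K} ν_n(q). -/
open Finset in
/-- The mean minimizes the weighted mean square deviation. -/
theorem sum_mul_sub_mean_sq_le {ι : Type*} (s : Finset ι) (w f : ι → ℝ) (hw : ∑ i ∈ s, w i = 1)
    (a : ℝ) :
    ∑ i ∈ s, w i * (f i - ∑ j ∈ s, w j * f j) ^ 2 ≤ ∑ i ∈ s, w i * (f i - a) ^ 2 := by
  set m := ∑ j ∈ s, w j * f j with hm
  have key : ∑ i ∈ s, w i * (f i - a) ^ 2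
      = ∑ i ∈ s, w i * (f i - m) ^ 2 + (m - a) ^ 2 := by
    have h : ∀ i ∈ s, w i * (f i - a) ^ 2
        = w i * (f i - m) ^ 2 + (2 * (m - a) * (w i * f i) - (m - a) * (m + a) * w i) := by
      intro i _
      ring
    rw [sum_congr rfl h, sum_add_distrib, sum_sub_distrib, ← mul_sum, ← mul_sum, hw, ← hm]
    ring
  rw [key]
  nlinarith [sq_nonneg (m - a)]

open Finset in
/-- Cauchy–Schwarz bound for an increment in terms of the unit increments. -/
theorem sub_sq_le_mul_sum_Ico (f : ℕ → ℝ) {q d : ℕ} (h : q ≤ d) :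
    (f q - f d) ^ 2 ≤ ((d : ℝ) - q) * ∑ i ∈ Ico q d, (f (i + 1) - f i) ^ 2 := by
  have h1 : f d - f q = ∑ i ∈ Ico q d, (f (i + 1) - f i) := (sum_Ico_sub f h).symm
  have h2 := sq_sum_le_card_mul_sum_sq (s := Ico q d) (f := fun i => f (i + 1) - f i)
  rw [← h1, Nat.card_Ico, Nat.cast_sub h] at h2
  nlinarith

/-- A sequence whose consecutive ratios lie in `[r⁻¹, r]` varies by at most a power of `r`. -/
theorem le_pow_mul_of_ratio_le (u : ℕ → ℝ) {r : ℝ} (hr : 0 ≤ r) {q d : ℕ} (hqd : q ≤ d)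
    (h : ∀ i, q ≤ i → i < d → u i ≤ r * u (i + 1) ∧ u (i + 1) ≤ r * u i) :
    u q ≤ r ^ (d - q) * u d ∧ u d ≤ r ^ (d - q) * u q := by
  induction d, hqd using Nat.le_induction with
  | base => simp
  | succ d hd ih =>
    obtain ⟨h1, h2⟩ := ih fun i hi hid => h i hi (by omega)
    obtain ⟨h3, h4⟩ := h d hd (by omega)
    rw [show d + 1 - q = (d - q) + 1 by omega, pow_succ]
    have hp : 0 ≤ r ^ (d - q) := pow_nonneg hr _
    constructor
    · calc u q ≤ r ^ (d - q) * u d := h1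
        _ ≤ r ^ (d - q) * (r * u (d + 1)) := by gcongr
        _ = _ := by ring
    · calc u (d + 1) ≤ r * u d := h4
        _ ≤ r * (r ^ (d - q) * u q) := by gcongr
        _ = _ := by ring

open Finset in
/-- Weighted Poincaré inequality on an interval of length of order `s`, for a nearly uniform
measure `ν` and a weight which is constant except for an atom of order `s` at the right end. -/
theorem weighted_variance_le_of_comparable {a d : ℕ} (had : a ≤ d) (ν b f : ℕ → ℝ)
    {s M B lam E : ℝ} (hs : 1 ≤ s) (hlen : (d : ℝ) - a ≤ 2 * s) (hM : 0 < M) (hB : 0 ≤ B)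
    (hlam : 0 < lam) (hν : ∀ q, 0 < ν q)
    (hup : ∀ q ∈ Icc a d, ν q ≤ M * ν d) (hlow : ∀ q ∈ Icc a d, ν d ≤ M * ν q)
    (hb : ∀ q ∈ Icc a d, q ≠ d → b q = B) (hbd : s ≤ b d)
    (hE : ∑ q ∈ Ico a d, lam * ν q * (f (q + 1) - f q) ^ 2 ≤ E) :
    ∑ q ∈ Icc a d, b q * ν q / (∑ p ∈ Icc a d, b p * ν p)
        * (f q - ∑ p ∈ Icc a d, b p * ν p / (∑ p ∈ Icc a d, b p * ν p) * f p) ^ 2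
      ≤ 18 * M ^ 3 * B * s ^ 2 / lam / (∑ q ∈ Icc a d, ν q) * E := by
  have hνd := hν d
  have hdK : d ∈ Icc a d := by simp [had]
  have hbpos : ∀ q ∈ Icc a d, 0 ≤ b q := by
    intro q hq
    by_cases h : q = d
    · subst h; linarith
    · rw [hb q hq h]; exact hB
  have hZ : s * ν d ≤ ∑ p ∈ Icc a d, b p * ν p := by
    calc s * ν d ≤ b d * ν d := by gcongr
      _ ≤ _ := single_le_sum (f := fun p => b p * ν p)
        (fun q hq => mul_nonneg (hbpos q hq) (hν q).le) hdK
  have hV : ∑ q ∈ Icc a d, ν q ≤ 3 * s * M * ν d := by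
    have h := sum_le_card_nsmul _ _ _ hup
    rw [Nat.card_Icc, nsmul_eq_mul, Nat.cast_sub (by omega)] at h
    push_cast at h
    calc _ ≤ _ := h
      _ ≤ 3 * s * (M * ν d) := by gcongr; linarith
      _ = _ := by ring
  have hVpos : 0 < ∑ q ∈ Icc a d, ν q := sum_pos (fun q _ => hν q) ⟨d, hdK⟩
  set V := ∑ q ∈ Icc a d, ν q with hVdef
  set Z := ∑ p ∈ Icc a d, b p * ν p with hZdef
  have hsν : 0 < s * ν d := by positivity
  have hZpos : 0 < Z := hsν.trans_le hZ
  have hEpos : 0 ≤ E := le_trans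
    (sum_nonneg fun q _ => mul_nonneg (mul_pos hlam (hν q)).le (sq_nonneg _)) hE
  have hsum : ∑ q ∈ Icc a d, b q * ν q / Z = 1 := by
    rw [← sum_div, ← hZdef, div_self hZpos.ne']
  have hgrad : ∑ i ∈ Ico a d, (f (i + 1) - f i) ^ 2 ≤ M * E / (lam * ν d) := by
    rw [le_div_iff₀ (by positivity), sum_mul]
    calc ∑ i ∈ Ico a d, (f (i + 1) - f i) ^ 2 * (lam * ν d)
        ≤ ∑ i ∈ Ico a d, M * (lam * ν i * (f (i + 1) - f i) ^ 2) := by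
          apply sum_le_sum
          intro i hi
          have hi' : i ∈ Icc a d := by
            rw [mem_Ico] at hi
            rw [mem_Icc]
            omega
          calc (f (i + 1) - f i) ^ 2 * (lam * ν d)
              ≤ (f (i + 1) - f i) ^ 2 * (lam * (M * ν i)) := by gcongr; exact hlow i hi'
            _ = _ := by ring
      _ ≤ M * E := by rw [← mul_sum]; gcongr
  have hosc : ∀ q ∈ Icc a d, (f q - f d) ^ 2 ≤ 2 * s * (M * E / (lam * ν d)) := by
    intro q hq
    rw [mem_Icc] at hq
    have haq : (a : ℝ) ≤ q := by exact_mod_cast hq.1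
    calc (f q - f d) ^ 2 ≤ ((d : ℝ) - q) * ∑ i ∈ Ico q d, (f (i + 1) - f i) ^ 2 :=
          sub_sq_le_mul_sum_Ico f hq.2
      _ ≤ (2 * s) * ∑ i ∈ Ico a d, (f (i + 1) - f i) ^ 2 := by
          apply mul_le_mul (by linarith) _ (sum_nonneg fun i _ => sq_nonneg _) (by linarith)
          exact sum_le_sum_of_subset_of_nonneg (Ico_subset_Ico_left hq.1)
            fun i _ _ => sq_nonneg _
      _ ≤ _ := by gcongr
  set D := 2 * s * (M * E / (lam * ν d)) with hD
  have hDpos : 0 ≤ D := by positivity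
  calc _ ≤ ∑ q ∈ Icc a d, b q * ν q / Z * (f q - f d) ^ 2 :=
        sum_mul_sub_mean_sq_le _ _ f hsum (f d)
    _ ≤ ∑ q ∈ Icc a d, B * D / Z * ν q := by
        apply sum_le_sum
        intro q hq
        have hνq := hν q
        by_cases h : q = d
        · subst h
          rw [sub_self, zero_pow two_ne_zero, mul_zero]
          positivity
        · rw [hb q hq h]
          calc B * ν q / Z * (f q - f d) ^ 2 ≤ B * ν q / Z * D := by
                gcongr; exact hosc q hq
            _ = _ := by ring
    _ = B * D / Z * V := by rw [← mul_sum]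
    _ ≤ B * D / (s * ν d) * (3 * s * M * ν d) := by gcongr
    _ = 6 * M ^ 2 * B * s * E / lam / ν d := by
        rw [hD]; field_simp; ring
    _ ≤ 6 * M ^ 2 * B * s * E / lam / (V / (3 * s * M)) := by
        gcongr
        rw [div_le_iff₀ (by positivity)]
        linarith
    _ = _ := by field_simp; ring

section Stationary

variable {n : ℕ} {lam c : ℝ} {ν : ℕ → ℝ}

theorem stationary_pos (hlam : 0 < lam) (hc : 0 < c) (hn : 0 < n)
    (h1 : ∀ q ≤ n, ν q = c * lam ^ q / (Nat.factorial q : ℝ))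
    (h2 : ∀ q > n, ν q = c * (lam ^ n / (Nat.factorial n : ℝ)) * (lam / n) ^ (q - n)) (q : ℕ) :
    0 < ν q := by
  have hn' : (0 : ℝ) < n := by exact_mod_cast hn
  rcases le_or_gt q n with h | h
  · rw [h1 q h]; positivity
  · rw [h2 q h]; positivity

theorem stationary_succ_of_lt
    (h1 : ∀ q ≤ n, ν q = c * lam ^ q / (Nat.factorial q : ℝ)) {q : ℕ} (hq : q < n) :
    ((q : ℝ) + 1) * ν (q + 1) = lam * ν q := by
  have hf : (0 : ℝ) < (Nat.factorial q : ℝ) := by positivity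
  rw [h1 q hq.le, h1 (q + 1) hq, Nat.factorial_succ]
  push_cast
  field_simp
  ring

theorem stationary_succ_of_ge (hn : 0 < n)
    (h1 : ∀ q ≤ n, ν q = c * lam ^ q / (Nat.factorial q : ℝ))
    (h2 : ∀ q > n, ν q = c * (lam ^ n / (Nat.factorial n : ℝ)) * (lam / n) ^ (q - n))
    {q : ℕ} (hq : n ≤ q) :
    (n : ℝ) * ν (q + 1) = lam * ν q := by
  have hn' : (0 : ℝ) < n := by exact_mod_cast hn
  have key : ν q = c * (lam ^ n / (Nat.factorial n : ℝ)) * (lam / n) ^ (q - n) := by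
    rcases hq.eq_or_lt with h | h
    · subst h; rw [h1 n le_rfl]; simp [mul_div_assoc]
    · exact h2 q h
  rw [h2 (q + 1) (by omega), key, show q + 1 - n = (q - n) + 1 by omega, pow_succ]
  field_simp

theorem stationary_mul_le (hlam : 0 < lam) (hc : 0 < c) (hn : 0 < n)
    (h1 : ∀ q ≤ n, ν q = c * lam ^ q / (Nat.factorial q : ℝ))
    (h2 : ∀ q > n, ν q = c * (lam ^ n / (Nat.factorial n : ℝ)) * (lam / n) ^ (q - n)) (q : ℕ) :
    lam * ν q ≤ n * ν (q + 1) := by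
  rcases lt_or_ge q n with h | h
  · rw [← stationary_succ_of_lt h1 h]
    have := stationary_pos hlam hc hn h1 h2 (q + 1)
    gcongr
    exact_mod_cast h
  · exact (stationary_succ_of_ge hn h1 h2 h).ge

/-- The Dirichlet form of a square integrable function converges. -/
theorem summable_dirichlet (hlam : 0 < lam) (hc : 0 < c) (hn : 0 < n)
    (h1 : ∀ q ≤ n, ν q = c * lam ^ q / (Nat.factorial q : ℝ))
    (h2 : ∀ q > n, ν q = c * (lam ^ n / (Nat.factorial n : ℝ)) * (lam / n) ^ (q - n))
    {f : ℕ → ℝ} (hf : Summable fun q => ν q * f q ^ 2) :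
    Summable fun q => lam * ν q * (f (q + 1) - f q) ^ 2 := by
  have hpos := stationary_pos hlam hc hn h1 h2
  have hf' : Summable fun q => ν (q + 1) * f (q + 1) ^ 2 :=
    (summable_nat_add_iff (f := fun q => ν q * f q ^ 2) 1).2 hf
  refine Summable.of_nonneg_of_le (fun q => ?_) (fun q => ?_)
    ((hf'.mul_left (2 * (n : ℝ))).add (hf.mul_left (2 * lam)))
  · have := hpos q
    positivity
  · have h3 := stationary_mul_le hlam hc hn h1 h2 q
    have h4 : (f (q + 1) - f q) ^ 2 ≤ 2 * f (q + 1) ^ 2 + 2 * f q ^ 2 := by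
      nlinarith [sq_nonneg (f (q + 1) + f q)]
    have h5 := hpos q
    calc lam * ν q * (f (q + 1) - f q) ^ 2
        ≤ lam * ν q * (2 * f (q + 1) ^ 2 + 2 * f q ^ 2) := by gcongr
      _ = 2 * ((lam * ν q) * f (q + 1) ^ 2) + 2 * lam * (ν q * f q ^ 2) := by ring
      _ ≤ 2 * ((n * ν (q + 1)) * f (q + 1) ^ 2) + 2 * lam * (ν q * f q ^ 2) := by gcongr
      _ = _ := by ring

/-- Near the mean, consecutive values of the stationary distribution are comparable. -/
theorem stationary_ratio_le {s : ℝ} (hs : 1 ≤ s) (hsn : 5 * s ≤ n) (hlam : lam = n - s)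
    (hpos : ∀ q, 0 < ν q) (h1 : ∀ q ≤ n, ν q = c * lam ^ q / (Nat.factorial q : ℝ))
    {i : ℕ} (hi : (n : ℝ) - 2 * s - 1 ≤ i) (hin : i < n) :
    ν i ≤ (1 + 2 * s / n) * ν (i + 1) ∧ ν (i + 1) ≤ (1 + 2 * s / n) * ν i := by
  have hn : (0 : ℝ) < n := by linarith
  have hin' : (i : ℝ) + 1 ≤ n := by exact_mod_cast hin
  have hrec := stationary_succ_of_lt h1 hin
  have hp := hpos i
  have hp' := hpos (i + 1)
  have hl : 0 < lam := by linarith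
  have e : 2 * s / n * n = 2 * s := by field_simp
  have ht : 0 ≤ 2 * s / (n : ℝ) := by positivity
  set t := 2 * s / (n : ℝ) with htd
  have ht1 : t ≤ 2 / 5 := by rw [htd, div_le_iff₀ hn]; linarith
  constructor
  · refine le_of_mul_le_mul_left ?_ hl
    rw [← hrec]
    have : (i : ℝ) + 1 ≤ lam * (1 + t) := by rw [hlam]; nlinarith
    nlinarith
  · refine le_of_mul_le_mul_left ?_ (show (0 : ℝ) < i + 1 by positivity)
    rw [hrec]
    have : lam ≤ ((i : ℝ) + 1) * (1 + t) := by rw [hlam]; nlinarith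
    nlinarith

end Stationary


/-- Weighted local Poincaré inequality for the M/M/n queue in the
(super-)Halfin-Whitt regime (Lemma 2 of the paper): there are universal constants
`Δ₁, Δ₂ > 0` such that the `(b,ν)`-weighted variance on
`K = {⌊2λ⌋−n, …, n−1}` is at most `((Δ₁ n^{2−4α} + Δ₂ n^{3−6α})/ν(K))·E(f,f)`. -/
theorem mmn_weighted_local_poincare_super_halfin_whitt :
    ∃ Δ₁ > (0 : ℝ), ∃ Δ₂ > (0 : ℝ),
      ∀ (α : ℝ), 1 / 2 ≤ α → α < 1 →
      ∀ (n : ℕ), 110 ≤ n →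
      ∀ (lam : ℝ), lam = (n : ℝ) - (n : ℝ) ^ ((1 : ℝ) - α) →
      ∀ (ν : ℕ → ℝ) (c : ℝ), 0 < c →
      (∀ q ≤ n, ν q = c * lam ^ q / (Nat.factorial q : ℝ)) →
      (∀ q > n, ν q = c * (lam ^ n / (Nat.factorial n : ℝ)) * (lam / n) ^ (q - n)) →
      (∑' q, ν q) = 1 →
      ∀ (K : Finset ℕ), K = Finset.Icc (⌊2 * lam⌋ - n).toNat (n - 1) →
      ∀ (b : ℕ → ℝ),
        (∀ q, b q =
          if q ∈ K then
            (if q = n - 1 then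
               (n : ℝ) ^ ((1 : ℝ) - α) * (1 + 1 / (4 * ((n : ℝ) ^ α - 1)))
             else
               ((n : ℝ) ^ ((1 : ℝ) - 2 * α) / (1 - (n : ℝ) ^ (-α)))
                 * Real.exp ((n : ℝ) ^ ((1 : ℝ) - 2 * α) / (1 - (n : ℝ) ^ (-α))))
          else 0) →
      ∀ (τ : ℕ → ℝ), (∀ q, τ q = b q * ν q / ∑ p ∈ K, b p * ν p) →
      ∀ f : ℕ → ℝ, (Summable fun q => ν q * f q ^ 2) →
        (∑' q, τ q * (f q - ∑' p, τ p * f p) ^ 2)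
          ≤ ((Δ₁ * (n : ℝ) ^ ((2 : ℝ) - 4 * α) + Δ₂ * (n : ℝ) ^ ((3 : ℝ) - 6 * α))
                / ∑ q ∈ K, ν q)
              * ∑' q, lam * ν q * (f (q + 1) - f q) ^ 2 := by
  refine ⟨72 * Real.exp 4 ^ 3 * Real.exp 2, by positivity, 1, one_pos, ?_⟩
  intro α hα1 hα2 n hn lam hlam ν c hc h1 h2 _ K hK b hb τ hτ f hf
  have hn110 : (110 : ℝ) ≤ n := by exact_mod_cast hn
  have hnpos : (0 : ℝ) < n := by linarith
  set s := (n : ℝ) ^ ((1 : ℝ) - α) with hs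
  set x := (n : ℝ) ^ ((1 : ℝ) - 2 * α) with hx
  have hs1 : 1 ≤ s := Real.one_le_rpow (by linarith) (by linarith)
  have hx1 : x ≤ 1 := Real.rpow_le_one_of_one_le_of_nonpos (by linarith) (by linarith)
  have hxpos : 0 < x := by positivity
  have hsx : s ^ 2 = n * x := by
    rw [hs, hx, ← Real.rpow_natCast, ← Real.rpow_mul hnpos.le, ← Real.rpow_one_add' hnpos.le]
    · congr 1; push_cast; ring
    · linarith
  have hε : (n : ℝ) ^ (-α) = s / n := by
    rw [hs, eq_div_iff hnpos.ne', ← Real.rpow_add_one hnpos.ne']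
    congr 1; ring
  have hx2 : (n : ℝ) ^ ((2 : ℝ) - 4 * α) = x ^ 2 := by
    rw [hx, ← Real.rpow_natCast, ← Real.rpow_mul hnpos.le]
    congr 1; push_cast; ring
  have hnα : 1 < (n : ℝ) ^ α := Real.one_lt_rpow (by linarith) (by linarith)
  have hsn : 5 * s ≤ n := by nlinarith
  have hlampos : 0 < lam := by linarith
  have hpos := stationary_pos hlampos hc (by omega) h1 h2
  obtain ⟨d, rfl⟩ : ∃ d, n = d + 1 := ⟨n - 1, by omega⟩
  rw [Nat.add_sub_cancel] at hK
  simp only [Nat.add_sub_cancel] at hb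
  set a := (⌊2 * lam⌋ - ((d + 1 : ℕ) : ℤ)).toNat with ha
  push_cast at *
  have hfl1 := Int.lt_floor_add_one (2 * lam)
  have hfl2 := Int.floor_le (2 * lam)
  have haz : ((d : ℤ) + 1) ≤ ⌊2 * lam⌋ := by
    rw [Int.le_floor]; push_cast; linarith
  have hacast : (a : ℝ) = (⌊2 * lam⌋ : ℝ) - (d + 1) := by
    have h : (a : ℤ) = ⌊2 * lam⌋ - ((d : ℤ) + 1) := by
      rw [ha, Int.toNat_of_nonneg]
      omega
    exact_mod_cast congrArg (Int.cast : ℤ → ℝ) h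
  have had : a ≤ d := by
    have : (a : ℝ) ≤ d := by linarith
    exact_mod_cast this
  set t := s / ((d : ℝ) + 1) with ht
  have ht5 : t ≤ 1 / 5 := by rw [ht, div_le_iff₀ hnpos]; linarith
  have htpos : 0 < t := by positivity
  set y := x / (1 - t) with hy
  have hypos : 0 < y := div_pos hxpos (by linarith)
  have hyx : y ≤ 2 * x := by rw [hy, div_le_iff₀ (by linarith)]; nlinarith
  have hcomp : ∀ q ∈ Finset.Icc a d, ν q ≤ Real.exp 4 * ν d ∧ ν d ≤ Real.exp 4 * ν q := by
    intro q hq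
    rw [Finset.mem_Icc] at hq
    have haq : (a : ℝ) ≤ q := by exact_mod_cast hq.1
    have h := le_pow_mul_of_ratio_le ν (r := 1 + 2 * s / ((d : ℝ) + 1)) (by positivity) hq.2
      fun i hqi hid => by
        have hqi' : (q : ℝ) ≤ i := by exact_mod_cast hqi
        have := stationary_ratio_le (n := d + 1) hs1 (by push_cast; linarith)
          (by push_cast; linarith) hpos h1 (i := i) (by push_cast; linarith) (by omega)
        push_cast at this
        exact this
    have hle : (1 + 2 * s / ((d : ℝ) + 1)) ^ (d - q) ≤ Real.exp 4 := by
      calc (1 + 2 * s / ((d : ℝ) + 1)) ^ (d - q)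
          ≤ Real.exp (2 * s / ((d : ℝ) + 1)) ^ (d - q) := by
            gcongr
            linarith [Real.add_one_le_exp (2 * s / ((d : ℝ) + 1))]
        _ = Real.exp (((d : ℝ) - q) * (2 * s / ((d : ℝ) + 1))) := by
            rw [← Real.exp_nat_mul, Nat.cast_sub hq.2]
        _ ≤ Real.exp 4 := by
            apply Real.exp_le_exp.2
            calc ((d : ℝ) - q) * (2 * s / ((d : ℝ) + 1))
                ≤ (2 * s) * (2 * s / ((d : ℝ) + 1)) := by gcongr; linarith
              _ = 4 * (s ^ 2 / ((d : ℝ) + 1)) := by ring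
              _ = 4 * x := by rw [hsx]; field_simp
              _ ≤ 4 := by linarith
    have hq0 := hpos q
    have hd0 := hpos d
    exact ⟨h.1.trans (by gcongr), h.2.trans (by gcongr)⟩
  have hsummable := summable_dirichlet hlampos hc (Nat.succ_pos d) h1
    (by push_cast; exact h2) hf
  have hnonneg : ∀ q, 0 ≤ lam * ν q * (f (q + 1) - f q) ^ 2 := fun q =>
    mul_nonneg (mul_pos hlampos (hpos q)).le (sq_nonneg _)
  have hE := hsummable.sum_le_tsum (Finset.Ico a d) fun q _ => hnonneg q
  have hE0 : 0 ≤ ∑' q, lam * ν q * (f (q + 1) - f q) ^ 2 := tsum_nonneg hnonneg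
  have hV0 : 0 ≤ ∑ q ∈ Finset.Icc a d, ν q := Finset.sum_nonneg fun q _ => (hpos q).le
  have hτ0 : ∀ q ∉ Finset.Icc a d, τ q = 0 := by
    intro q hq
    rw [hτ, hb, hK, if_neg hq]
    simp
  rw [tsum_eq_sum (s := Finset.Icc a d) fun q hq => by rw [hτ0 q hq, zero_mul],
    tsum_eq_sum (s := Finset.Icc a d) fun q hq => by rw [hτ0 q hq, zero_mul]]
  simp only [hτ, hK]
  have hB : ∀ q ∈ Finset.Icc a d, q ≠ d → b q = y * Real.exp y := by
    intro q hq hqd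
    rw [hb, hK, if_pos hq, if_neg hqd, hε]
  have hbd : s ≤ b d := by
    rw [hb, hK, if_pos (by simp [had]), if_pos rfl]
    have : 0 ≤ 1 / (4 * (((d : ℝ) + 1) ^ α - 1)) := by
      apply div_nonneg zero_le_one; linarith
    nlinarith
  refine (weighted_variance_le_of_comparable had ν b f hs1 (by linarith) (Real.exp_pos 4)
    (by positivity) hlampos hpos (fun q hq => (hcomp q hq).1) (fun q hq => (hcomp q hq).2)
    hB hbd hE).trans ?_
  gcongr
  rw [hx2]
  have hz : 0 ≤ 1 * ((d : ℝ) + 1) ^ ((3 : ℝ) - 6 * α) := by positivity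
  refine le_trans ?_ (le_add_of_nonneg_right hz)
  have hsl : s ^ 2 / lam ≤ 2 * x := by
    rw [div_le_iff₀ hlampos, hsx]
    nlinarith
  calc 18 * Real.exp 4 ^ 3 * (y * Real.exp y) * s ^ 2 / lam
      = 18 * Real.exp 4 ^ 3 * (y * Real.exp y) * (s ^ 2 / lam) := by ring
    _ ≤ 18 * Real.exp 4 ^ 3 * ((2 * x) * Real.exp 2) * (2 * x) := by
        gcongr
        linarith
    _ = 72 * Real.exp 4 ^ 3 * Real.exp 2 * x ^ 2 := by ring
end

section
/- (Local canonical path method) Let m < M be natural numbers, K = {m, m+1, …, M}, let μ be a probability distribution supported on K with μ(x) > 0 for every x ∈ K, and let Q(k) > 0 be given for every integer k with m ≤ k ≤ M−1. Define C_L = max over integers k with m ≤ k ≤ M−1 of (Σ_{x,y ∈ K with x ≤ k ≤ y−1} (y − x)·μ(x)·μ(y)) / Q(k). Then for every f : K → ℝ: Σ_{x∈K} μ(x)·(f(x) − Σ_{y∈K} μ(y)f(y))² ≤ C_L · Σ_{k=m}^{M−1} Q(k)·(f(k+1) − f(k))². -/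
open Finset in
/-- The variance of `f` under `μ` as a sum over increasing pairs. -/
theorem sum_mul_sub_mean_sq_eq_sum_lt {ι : Type*} [LinearOrder ι] (s : Finset ι) (μ f : ι → ℝ)
    (hμ : ∑ x ∈ s, μ x = 1) :
    ∑ x ∈ s, μ x * (f x - ∑ y ∈ s, μ y * f y) ^ 2 =
      ∑ x ∈ s, ∑ y ∈ s, if x < y then μ x * μ y * (f y - f x) ^ 2 else 0 := by
  set a := ∑ y ∈ s, μ y * f y with ha
  set b := ∑ y ∈ s, μ y * f y ^ 2 with hb
  have hvar : ∑ x ∈ s, μ x * (f x - a) ^ 2 = b - a ^ 2 := by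
    have h : ∀ x ∈ s, μ x * (f x - a) ^ 2 =
        μ x * f x ^ 2 - 2 * a * (μ x * f x) + a ^ 2 * μ x := fun x _ => by ring
    rw [sum_congr rfl h, sum_add_distrib, sum_sub_distrib, ← mul_sum, ← mul_sum, hμ, ← ha, ← hb]
    ring
  have hpairs : ∑ x ∈ s, ∑ y ∈ s, μ x * μ y * (f y - f x) ^ 2 = 2 * (b - a ^ 2) := by
    have h : ∀ x ∈ s, ∑ y ∈ s, μ x * μ y * (f y - f x) ^ 2 =
        b * μ x - 2 * a * (μ x * f x) + μ x * f x ^ 2 := fun x _ => by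
      have h' : ∀ y ∈ s, μ x * μ y * (f y - f x) ^ 2 =
          μ x * (μ y * f y ^ 2) - 2 * (μ x * f x) * (μ y * f y) + μ x * f x ^ 2 * μ y :=
        fun y _ => by ring
      rw [sum_congr rfl h', sum_add_distrib, sum_sub_distrib, ← mul_sum, ← mul_sum, ← mul_sum,
        hμ, ← ha, ← hb]
      ring
    rw [sum_congr rfl h, sum_add_distrib, sum_sub_distrib, ← mul_sum, ← mul_sum, hμ, ← ha, ← hb]
    ring
  have hsplit : ∑ x ∈ s, ∑ y ∈ s, μ x * μ y * (f y - f x) ^ 2 =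
      (∑ x ∈ s, ∑ y ∈ s, if x < y then μ x * μ y * (f y - f x) ^ 2 else 0) +
        ∑ x ∈ s, ∑ y ∈ s, if y < x then μ y * μ x * (f x - f y) ^ 2 else 0 := by
    rw [← sum_add_distrib]
    refine sum_congr rfl fun x _ => ?_
    rw [← sum_add_distrib]
    refine sum_congr rfl fun y _ => ?_
    rcases lt_trichotomy x y with h | rfl | h
    · simp [h, h.not_gt]
    · simp
    · simp only [h, h.not_gt, if_true, if_false]
      ring
  rw [sum_comm (f := fun x y => if y < x then μ y * μ x * (f x - f y) ^ 2 else 0)] at hsplit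
  linarith

open Finset in
theorem sq_sub_le_sub_mul_sum_Ico (f : ℕ → ℝ) {x y : ℕ} (h : x ≤ y) :
    (f y - f x) ^ 2 ≤ ((y : ℝ) - x) * ∑ k ∈ Ico x y, (f (k + 1) - f k) ^ 2 := by
  rw [← sum_Ico_sub f h]
  have := sq_sum_le_card_mul_sum_sq (s := Ico x y) (f := fun k => f (k + 1) - f k)
  rwa [Nat.card_Ico, Nat.cast_sub h] at this

/-- Local canonical path method (Lemma 5 of the paper) on the interval
`K = {m, …, M}`: the variance of `f` under `μ` is bounded by the congestion constant
`C_L` times the edge Dirichlet form `Σ_k Q(k)·(f(k+1) − f(k))²`. -/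
theorem local_canonical_path_method
    (m M : ℕ) (hmM : m < M)
    (μ : ℕ → ℝ)
    (hμpos : ∀ x ∈ Finset.Icc m M, 0 < μ x)
    (hμ1 : ∑ x ∈ Finset.Icc m M, μ x = 1)
    (Q : ℕ → ℝ) (hQ : ∀ k, m ≤ k → k ≤ M - 1 → 0 < Q k)
    (CL : ℝ)
    (hCL : CL = (Finset.Icc m (M - 1)).sup'
        (Finset.nonempty_Icc.mpr (by omega))
        (fun k =>
          (∑ x ∈ Finset.Icc m M, ∑ y ∈ Finset.Icc m M,
              if x ≤ k ∧ k + 1 ≤ y then ((y : ℝ) - (x : ℝ)) * μ x * μ y else 0)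
            / Q k)) :
    ∀ f : ℕ → ℝ,
      (∑ x ∈ Finset.Icc m M, μ x * (f x - ∑ y ∈ Finset.Icc m M, μ y * f y) ^ 2)
        ≤ CL * ∑ k ∈ Finset.Icc m (M - 1), Q k * (f (k + 1) - f k) ^ 2 := by
  intro f
  have hpair : ∀ x ∈ Finset.Icc m M, ∀ y ∈ Finset.Icc m M,
      (if x < y then μ x * μ y * (f y - f x) ^ 2 else 0) ≤
        ∑ k ∈ Finset.Icc m (M - 1),
          (if x ≤ k ∧ k + 1 ≤ y then ((y : ℝ) - (x : ℝ)) * μ x * μ y else 0) *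
            (f (k + 1) - f k) ^ 2 := by
    intro x hx y hy
    have hpath : (Finset.Icc m (M - 1)).filter (fun k => x ≤ k ∧ k + 1 ≤ y) = Finset.Ico x y := by
      ext k
      simp only [Finset.mem_filter, Finset.mem_Icc, Finset.mem_Ico] at hx hy ⊢
      omega
    simp only [ite_mul, zero_mul]
    rw [← Finset.sum_filter, hpath, ← Finset.mul_sum]
    split_ifs with hxy
    · calc μ x * μ y * (f y - f x) ^ 2
          ≤ μ x * μ y * (((y : ℝ) - x) * ∑ k ∈ Finset.Ico x y, (f (k + 1) - f k) ^ 2) :=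
            mul_le_mul_of_nonneg_left (sq_sub_le_sub_mul_sum_Ico f hxy.le)
              (mul_pos (hμpos x hx) (hμpos y hy)).le
        _ = _ := by ring
    · simp [Finset.Ico_eq_empty hxy]
  rw [sum_mul_sub_mean_sq_eq_sum_lt _ μ f hμ1]
  refine (Finset.sum_le_sum fun x hx => Finset.sum_le_sum fun y hy => hpair x hx y hy).trans ?_
  rw [Finset.sum_congr rfl fun x _ => Finset.sum_comm, Finset.sum_comm, Finset.mul_sum]
  refine Finset.sum_le_sum fun k hk => ?_
  simp only [← Finset.sum_mul]
  rw [← mul_assoc]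
  refine mul_le_mul_of_nonneg_right ?_ (sq_nonneg _)
  obtain ⟨hmk, hkM⟩ := Finset.mem_Icc.mp hk
  rw [← div_le_iff₀ (hQ k hmk hkM), hCL]
  exact Finset.le_sup' (fun k => (∑ x ∈ Finset.Icc m M, ∑ y ∈ Finset.Icc m M,
    if x ≤ k ∧ k + 1 ≤ y then ((y : ℝ) - (x : ℝ)) * μ x * μ y else 0) / Q k) hk
end

section
/- Fix α ∈ (1/2, 1). For an integer n ≥ 110 let λ = n − n^{1−α}, let K = {⌊2λ⌋ − n, …, n−1}, and let ν_K(x) = (λ^x/x!)/(Σ_{y∈K} λ^y/y!) for x ∈ K. Then there exist functions L, U : ℕ → ℝ with lim_{n→∞} L(n) = lim_{n→∞} U(n) = 1/2 such that for every integer n ≥ 110 and every x ∈ K: L(n)·n^{α−1} ≤ ν_K(x) ≤ U(n)·n^{α−1}. (In particular, the restriction of the stationary distribution of the M/M/n queue to K is roughly uniform, of order n^{α−1} = 1/|K| up to constants tending to matching limits.) -/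
open Finset in
/-- If consecutive values of `f` on `{a, …, b}` differ by a factor of at most `exp r`, then any
two values there differ by a factor of at most `exp (r * (b - a))`. -/
theorem le_exp_mul_of_step_le {f : ℕ → ℝ} {a b : ℕ} {r : ℝ} (hr : 0 ≤ r)
    (hf : ∀ x, 0 ≤ f x)
    (hup : ∀ y, a ≤ y → y + 1 ≤ b → f (y + 1) ≤ Real.exp r * f y)
    (hdown : ∀ y, a ≤ y → y + 1 ≤ b → f y ≤ Real.exp r * f (y + 1))
    {x y : ℕ} (hx : x ∈ Icc a b) (hy : y ∈ Icc a b) :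
    f x ≤ Real.exp (r * ((b : ℝ) - a)) * f y := by
  rw [mem_Icc] at hx hy
  have key : ∀ k z : ℕ, a ≤ z → z + k ≤ b →
      f (z + k) ≤ Real.exp (r * k) * f z ∧ f z ≤ Real.exp (r * k) * f (z + k) := by
    intro k
    induction k with
    | zero => intro z _ _; simp
    | succ k ih =>
      intro z hz hk
      obtain ⟨h1, h2⟩ := ih z hz (by lia)
      have h3 := hup (z + k) (by lia) (by lia)
      have h4 := hdown (z + k) (by lia) (by lia)
      have he : Real.exp (r * ((k + 1 : ℕ) : ℝ)) = Real.exp r * Real.exp (r * k) := by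
        rw [← Real.exp_add]; congr 1; push_cast; ring
      rw [he, ← add_assoc]
      constructor
      · calc f (z + k + 1) ≤ Real.exp r * f (z + k) := h3
          _ ≤ Real.exp r * (Real.exp (r * k) * f z) := by gcongr
          _ = _ := by ring
      · calc f z ≤ Real.exp (r * k) * f (z + k) := h2
          _ ≤ Real.exp (r * k) * (Real.exp r * f (z + k + 1)) := by gcongr
          _ = _ := by ring
  have mono : ∀ k : ℕ, a + k ≤ b → Real.exp (r * k) ≤ Real.exp (r * ((b : ℝ) - a)) := by
    intro k hk
    have : (a : ℝ) + k ≤ b := by exact_mod_cast hk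
    gcongr
    linarith
  rcases le_total x y with h | h
  · obtain ⟨k, rfl⟩ := Nat.exists_eq_add_of_le h
    exact (key k x hx.1 hy.2).2.trans
      (mul_le_mul_of_nonneg_right (mono k (by lia)) (hf _))
  · obtain ⟨k, rfl⟩ := Nat.exists_eq_add_of_le h
    exact (key k y hy.1 hx.2).1.trans
      (mul_le_mul_of_nonneg_right (mono k (by lia)) (hf _))

/-- If the values of a positive `f` on `s` differ by a factor of at most `C`, then the normalized
weights of `f` on `s` are within a factor `C` of `1 / #s`. -/
theorem div_sum_mem_of_le_mul {ι : Type*} {f : ι → ℝ} {s : Finset ι} {C : ℝ} (hC : 0 < C)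
    (hf : ∀ x ∈ s, 0 < f x) (h : ∀ x ∈ s, ∀ y ∈ s, f x ≤ C * f y) {x : ι} (hx : x ∈ s) :
    1 / (C * s.card) ≤ f x / ∑ y ∈ s, f y ∧ f x / ∑ y ∈ s, f y ≤ C / s.card := by
  have hs : (0 : ℝ) < s.card := by exact_mod_cast Finset.card_pos.2 ⟨x, hx⟩
  have hsum : 0 < ∑ y ∈ s, f y := Finset.sum_pos hf ⟨x, hx⟩
  have h1 : ∑ y ∈ s, f y ≤ s.card * (C * f x) := by
    simpa using Finset.sum_le_card_nsmul s f (C * f x) fun y hy => h y hy x hx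
  have h2 : s.card * f x ≤ C * ∑ y ∈ s, f y := by
    rw [Finset.mul_sum]
    simpa using Finset.card_nsmul_le_sum s (fun y => C * f y) (f x) fun y hy => h x hx y hy
  constructor
  · rw [div_le_div_iff₀ (by positivity) hsum]; linarith
  · rw [div_le_div_iff₀ hsum hs]; linarith

/-- With `d` at most a tenth of `n`, the Poisson weights of parameter `n - d` at two points of
`{n - ⌈2d⌉, …, n - 1}` differ by a factor of at most `exp (2d² / (n - 2d))`. -/
theorem poisson_weight_le_exp_mul {n : ℕ} {d : ℝ} (hd : 0 < d) (hdn : 10 * d ≤ n)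
    (hmn : ⌈2 * d⌉₊ ≤ n) {x y : ℕ}
    (hx : x ∈ Finset.Icc (n - ⌈2 * d⌉₊) (n - 1)) (hy : y ∈ Finset.Icc (n - ⌈2 * d⌉₊) (n - 1)) :
    ((n : ℝ) - d) ^ x / (x.factorial : ℝ) ≤
      Real.exp (2 * d ^ 2 / (n - 2 * d)) * (((n : ℝ) - d) ^ y / (y.factorial : ℝ)) := by
  have hm1 : (⌈2 * d⌉₊ : ℝ) < 2 * d + 1 := Nat.ceil_lt_add_one (by positivity)
  have hm0 : 0 < ⌈2 * d⌉₊ := Nat.ceil_pos.2 (by positivity)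
  set m := ⌈2 * d⌉₊
  have hl : (0 : ℝ) < n - d := by linarith
  have hq : (0 : ℝ) < n - 2 * d := by linarith
  have hr : 0 ≤ d / ((n : ℝ) - 2 * d) := by positivity
  have hexp : ((n : ℝ) - d) / (n - 2 * d) ≤ Real.exp (d / (n - 2 * d)) := by
    refine le_trans (le_of_eq ?_) (Real.add_one_le_exp _)
    rw [div_add_one hq.ne']
    ring
  have hcast : ((n - m : ℕ) : ℝ) = n - m := by push_cast [hmn]; ring
  have hcast1 : ((n - 1 : ℕ) : ℝ) = n - 1 := by
    rw [Nat.cast_sub (by lia)]; simp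
  have hpos : ∀ z : ℕ, 0 < ((n : ℝ) - d) ^ z / (z.factorial : ℝ) := fun z => by positivity
  have hsucc : ∀ z : ℕ, ((n : ℝ) - d) ^ (z + 1) / ((z + 1).factorial : ℝ) =
      ((n : ℝ) - d) / (z + 1) * (((n : ℝ) - d) ^ z / (z.factorial : ℝ)) := by
    intro z
    rw [Nat.factorial_succ, pow_succ]
    push_cast
    field_simp
  refine (le_exp_mul_of_step_le (f := fun z : ℕ => ((n : ℝ) - d) ^ z / (z.factorial : ℝ)) hr
    (fun z => (hpos z).le) ?_ ?_ hx hy).trans ?_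
  · intro z hz _
    have hz' : (n : ℝ) - m ≤ z := by rw [← hcast]; exact_mod_cast hz
    simp only [hsucc]
    refine mul_le_mul_of_nonneg_right (le_trans ?_ hexp) (hpos z).le
    gcongr
    linarith
  · intro z _ hz
    have hz' : (z : ℝ) + 1 ≤ n - 1 := by rw [← hcast1]; exact_mod_cast hz
    simp only [hsucc]
    rw [← mul_assoc]
    refine le_mul_of_one_le_left (hpos z).le ?_
    rw [← div_le_iff₀ (by positivity), one_div_div]
    refine le_trans ?_ hexp
    rw [div_le_div_iff₀ hl hq]
    nlinarith [sq_nonneg d]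
  · refine mul_le_mul_of_nonneg_right (Real.exp_le_exp.2 ?_) (hpos y).le
    rw [hcast, hcast1, div_mul_eq_mul_div]
    exact div_le_div_of_nonneg_right (by nlinarith) hq.le

/-- `d / ⌈2d⌉ → 1/2` along `d = n ^ (1 - α)`. -/
theorem tendsto_rpow_div_ceil_two_mul {α : ℝ} (hα : α < 1) :
    Filter.Tendsto (fun n : ℕ => (n : ℝ) ^ (1 - α) / (⌈2 * (n : ℝ) ^ (1 - α)⌉₊ : ℝ))
      Filter.atTop (nhds (1 / 2)) := by
  have hd : Filter.Tendsto (fun n : ℕ => (n : ℝ) ^ (1 - α)) Filter.atTop Filter.atTop :=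
    (tendsto_rpow_atTop (by linarith)).comp tendsto_natCast_atTop_atTop
  have h := ((tendsto_nat_ceil_mul_div_atTop (R := ℝ) (a := 2) (by norm_num)).comp hd).inv₀
    (by norm_num)
  rw [← one_div] at h
  refine h.congr fun n => ?_
  simp

/-- `2d² / (n - 2d) → 0` along `d = n ^ (1 - α)`. -/
theorem tendsto_two_mul_rpow_sq_div {α : ℝ} (hα1 : 1 / 2 < α) :
    Filter.Tendsto
      (fun n : ℕ => 2 * ((n : ℝ) ^ (1 - α)) ^ 2 / ((n : ℝ) - 2 * (n : ℝ) ^ (1 - α)))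
      Filter.atTop (nhds 0) := by
  have h1 : Filter.Tendsto (fun n : ℕ => (n : ℝ) ^ (-(2 * α - 1))) Filter.atTop (nhds 0) :=
    (tendsto_rpow_neg_atTop (by linarith)).comp tendsto_natCast_atTop_atTop
  have h2 : Filter.Tendsto (fun n : ℕ => (n : ℝ) ^ (-α)) Filter.atTop (nhds 0) :=
    (tendsto_rpow_neg_atTop (by linarith)).comp tendsto_natCast_atTop_atTop
  have h := (h1.const_mul 2).div ((h2.const_mul 2).const_sub 1) (by norm_num)
  rw [mul_zero, zero_div] at h
  refine h.congr' ?_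
  filter_upwards [Filter.eventually_gt_atTop 0] with n hn
  have hn' : (0 : ℝ) < n := by exact_mod_cast hn
  have e1 : ((n : ℝ) ^ (1 - α)) ^ 2 = n * (n : ℝ) ^ (-(2 * α - 1)) := by
    rw [← Real.rpow_natCast, ← Real.rpow_mul hn'.le, mul_comm (n : ℝ), ← Real.rpow_add_one hn'.ne']
    congr 1; push_cast; ring
  have e2 : (n : ℝ) ^ (1 - α) = n * (n : ℝ) ^ (-α) := by
    rw [sub_eq_add_neg, Real.rpow_add hn', Real.rpow_one]
  rw [e1, e2]
  simp only [Pi.div_apply]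
  rw [show (n : ℝ) - 2 * (n * (n : ℝ) ^ (-α)) = n * (1 - 2 * (n : ℝ) ^ (-α)) by ring,
    mul_left_comm, mul_div_mul_left _ _ (ne_of_gt hn')]

/-- The stationary distribution of the M/M/n queue restricted to
`K = {⌊2λ⌋−n, …, n−1}` is roughly uniform (Lemma 6 of the paper): there are
functions `L, U` with `L(n), U(n) → 1/2` such that
`L(n)·n^{α−1} ≤ ν_K(x) ≤ U(n)·n^{α−1}` for all `n ≥ 110` and `x ∈ K`. -/
theorem mmn_stationary_roughly_uniform_on_K
    (α : ℝ) (hα1 : 1 / 2 < α) (hα2 : α < 1) :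
    ∃ L U : ℕ → ℝ,
      Filter.Tendsto L Filter.atTop (nhds (1 / 2)) ∧
      Filter.Tendsto U Filter.atTop (nhds (1 / 2)) ∧
      ∀ n : ℕ, 110 ≤ n →
        ∀ lam : ℝ, lam = (n : ℝ) - (n : ℝ) ^ ((1 : ℝ) - α) →
        ∀ K : Finset ℕ, K = Finset.Icc (⌊2 * lam⌋ - n).toNat (n - 1) →
        ∀ x ∈ K,
          L n * (n : ℝ) ^ (α - 1)
              ≤ (lam ^ x / (Nat.factorial x : ℝ))
                  / ∑ y ∈ K, lam ^ y / (Nat.factorial y : ℝ) ∧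
          (lam ^ x / (Nat.factorial x : ℝ))
              / ∑ y ∈ K, lam ^ y / (Nat.factorial y : ℝ)
            ≤ U n * (n : ℝ) ^ (α - 1) := by
  refine ⟨fun n => (n : ℝ) ^ (1 - α) / (⌈2 * (n : ℝ) ^ (1 - α)⌉₊ : ℝ) /
      Real.exp (2 * ((n : ℝ) ^ (1 - α)) ^ 2 / ((n : ℝ) - 2 * (n : ℝ) ^ (1 - α))),
    fun n => (n : ℝ) ^ (1 - α) / (⌈2 * (n : ℝ) ^ (1 - α)⌉₊ : ℝ) *
      Real.exp (2 * ((n : ℝ) ^ (1 - α)) ^ 2 / ((n : ℝ) - 2 * (n : ℝ) ^ (1 - α))), ?_, ?_, ?_⟩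
  · have h := (tendsto_rpow_div_ceil_two_mul hα2).div
      (tendsto_two_mul_rpow_sq_div hα1).rexp (by simp)
    rw [Real.exp_zero, div_one] at h
    exact h
  · simpa using (tendsto_rpow_div_ceil_two_mul hα2).mul (tendsto_two_mul_rpow_sq_div hα1).rexp
  · rintro n hn lam rfl K hK x hx
    have hn' : (110 : ℝ) ≤ n := by exact_mod_cast hn
    have hinv : (n : ℝ) ^ (α - 1) = ((n : ℝ) ^ (1 - α))⁻¹ := by
      rw [← Real.rpow_neg (by linarith), neg_sub]
    have hd0 : 0 < (n : ℝ) ^ (1 - α) := Real.rpow_pos_of_pos (by linarith) _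
    have hsqrt : (n : ℝ) ^ (1 - α) ≤ √n := by
      rw [Real.sqrt_eq_rpow]
      exact Real.rpow_le_rpow_of_exponent_le (by linarith) (by linarith)
    beta_reduce
    rw [hinv]
    clear hinv
    generalize (n : ℝ) ^ (1 - α) = d at *
    have hdn : 10 * d ≤ n := by
      have h10 : 10 ≤ √(n : ℝ) := Real.le_sqrt_of_sq_le (by linarith)
      nlinarith [Real.mul_self_sqrt (show (0 : ℝ) ≤ n by linarith)]
    have hm1 : (⌈2 * d⌉₊ : ℝ) < 2 * d + 1 := Nat.ceil_lt_add_one (by positivity)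
    have hm2 : 2 * d ≤ ⌈2 * d⌉₊ := Nat.le_ceil _
    have hm0 : 0 < ⌈2 * d⌉₊ := Nat.ceil_pos.2 (by positivity)
    have hmn : ⌈2 * d⌉₊ ≤ n := by
      have : (⌈2 * d⌉₊ : ℝ) ≤ n := by linarith
      exact_mod_cast this
    have hfloor : ⌊2 * ((n : ℝ) - d)⌋ = 2 * (n : ℤ) - ⌈2 * d⌉₊ := by
      rw [Int.floor_eq_iff]
      push_cast
      constructor <;> linarith
    replace hK : K = Finset.Icc (n - ⌈2 * d⌉₊) (n - 1) := by
      rw [hK, hfloor]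
      congr 1
      lia
    subst hK
    have hcard : (Finset.Icc (n - ⌈2 * d⌉₊) (n - 1)).card = ⌈2 * d⌉₊ := by
      rw [Nat.card_Icc]
      lia
    have hl : (0 : ℝ) < n - d := by linarith
    obtain ⟨h1, h2⟩ := div_sum_mem_of_le_mul
      (f := fun z : ℕ => ((n : ℝ) - d) ^ z / (z.factorial : ℝ)) (Real.exp_pos _)
      (fun z _ => by positivity)
      (fun y hy z hz => poisson_weight_le_exp_mul hd0 hdn hmn hy hz) hx
    rw [hcard] at h1 h2
    have hm : (0 : ℝ) < ⌈2 * d⌉₊ := by exact_mod_cast hm0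
    refine ⟨le_trans (le_of_eq ?_) h1, h2.trans (le_of_eq ?_)⟩
    · field_simp
    · field_simp
end

section
/- Let α ≥ 1 be real, let n ≥ 2 be an integer, let λ = n − n^{1−α} (so 0 < λ < n), and let ν_n be the stationary distribution of the M/M/n queue with arrival rate λ and unit service rate. Then for every f : ℕ → ℝ with Σ_q ν_n(q)·f(q)² < ∞: Var_{ν_n}(f) ≤ (1/(√n − √λ)²)·E(f,f). (This is the Poincaré inequality with constant 1/(√n − √λ)² underlying the mixing bound χ(π_{n,t}, ν_n) ≤ e^{−(√n−√λ)²·t}·χ(π_{n,0}, ν_n) for the M/M/n queue when α ≥ 1.) -/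
open Finset in
/-- Discrete Hardy inequality for the partial sums of `ν * F`, from a positive supersolution `w`
on the edges of a path with conductances `e`. -/
theorem hardy_partial_sums (ν e w A F : ℕ → ℝ) (κ : ℝ)
    (hν : ∀ k, 0 < ν k) (he : ∀ k, 0 < e k) (hw : ∀ k, 0 < w k)
    (hA0 : ν 0 * A 0 = e 0 * w 0)
    (hA : ∀ k, ν (k + 1) * A (k + 1) = e (k + 1) * w (k + 1) - e k * w k)
    (hκ : ∀ k, κ * w k ≤ A k - A (k + 1)) (M : ℕ) :
    κ * ∑ k ∈ range M, (∑ j ∈ range (k + 1), ν j * F j) ^ 2 / e k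
        + (∑ j ∈ range (M + 1), ν j * F j) ^ 2 / (e M * w M) * A M
      ≤ ∑ k ∈ range (M + 1), ν k * F k ^ 2 := by
  induction M with
  | zero =>
    have h0 := (hν 0).ne'
    have h1 := (he 0).ne'
    have h2 := (hw 0).ne'
    have hA' : A 0 = e 0 * w 0 / ν 0 := by rw [← hA0]; field_simp
    simp only [range_zero, sum_empty, mul_zero, zero_add, range_one, sum_singleton]
    rw [hA']
    apply le_of_eq
    field_simp
  | succ M ih =>
    rw [sum_range_succ (n := M), sum_range_succ (fun k => ν k * F k ^ 2) (M + 1),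
      sum_range_succ (fun k => ν k * F k) (M + 1)]
    set T := ∑ j ∈ range (M + 1), ν j * F j
    set p := e M * w M with hp
    set p' := e (M + 1) * w (M + 1) with hp'
    have hp0 : 0 < p := mul_pos (he M) (hw M)
    have hp0' : 0 < p' := mul_pos (he _) (hw _)
    have hν' := hν (M + 1)
    have hA' : A (M + 1) = (p' - p) / ν (M + 1) := by
      rw [← hA M]; field_simp
    have picone : ((T + ν (M + 1) * F (M + 1)) ^ 2 / p' - T ^ 2 / p) * A (M + 1)
        ≤ ν (M + 1) * F (M + 1) ^ 2 := by
      have key : ν (M + 1) * F (M + 1) ^ 2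
          - ((T + ν (M + 1) * F (M + 1)) ^ 2 / p' - T ^ 2 / p) * A (M + 1)
          = p * p' / ν (M + 1) * ((T + ν (M + 1) * F (M + 1)) / p' - T / p) ^ 2 := by
        rw [hA']
        field_simp
        ring
      have : 0 ≤ p * p' / ν (M + 1) * ((T + ν (M + 1) * F (M + 1)) / p' - T / p) ^ 2 := by
        positivity
      linarith
    have step : κ * (T ^ 2 / e M) ≤ T ^ 2 / p * (A M - A (M + 1)) := by
      have h1 : κ * (T ^ 2 / e M) = T ^ 2 / p * (κ * w M) := by
        have := (he M).ne'
        have := (hw M).ne'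
        rw [hp]; field_simp
      rw [h1]
      exact mul_le_mul_of_nonneg_left (hκ M) (by positivity)
    linarith

open Finset in
/-- Summation by parts against the partial sums of `a`. -/
theorem sum_mul_eq_sub_sum_partial (a F : ℕ → ℝ) (N : ℕ) :
    ∑ k ∈ range (N + 1), a k * F k
      = (∑ j ∈ range (N + 1), a j) * F N
        - ∑ k ∈ range N, (∑ j ∈ range (k + 1), a j) * (F (k + 1) - F k) := by
  induction N with
  | zero => simp
  | succ N ih =>
    rw [sum_range_succ _ (N + 1), ih, sum_range_succ a (N + 1),
      sum_range_succ (fun k => (∑ j ∈ range (k + 1), a j) * (F (k + 1) - F k)) N]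
    ring

open Finset in
/-- Poincaré inequality for a centred function on a finite path. -/
theorem path_poincare_centred (ν e w A F : ℕ → ℝ) (κ : ℝ) (hκ0 : 0 < κ)
    (hν : ∀ k, 0 < ν k) (he : ∀ k, 0 < e k) (hw : ∀ k, 0 < w k)
    (hA0 : ν 0 * A 0 = e 0 * w 0)
    (hA : ∀ k, ν (k + 1) * A (k + 1) = e (k + 1) * w (k + 1) - e k * w k)
    (hκ : ∀ k, κ * w k ≤ A k - A (k + 1)) (N : ℕ)
    (hF : ∑ k ∈ range (N + 1), ν k * F k = 0) :
    κ * ∑ k ∈ range (N + 1), ν k * F k ^ 2 ≤ ∑ k ∈ range N, e k * (F (k + 1) - F k) ^ 2 := by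
  have hardy := hardy_partial_sums ν e w A F κ hν he hw hA0 hA hκ N
  have parts := sum_mul_eq_sub_sum_partial (fun k => ν k * F k) F N
  simp only [hF, zero_mul, zero_sub, ne_eq, OfNat.ofNat_ne_zero, not_false_eq_true, zero_pow,
    zero_div, add_zero] at hardy parts
  set T : ℕ → ℝ := fun k => ∑ j ∈ range (k + 1), ν j * F j with hT
  have young : ∀ k, -(2 * κ) * (T k * (F (k + 1) - F k))
      ≤ κ * (κ * (T k ^ 2 / e k)) + e k * (F (k + 1) - F k) ^ 2 := by
    intro k
    have h := he k
    have key : κ * (κ * (T k ^ 2 / e k)) + e k * (F (k + 1) - F k) ^ 2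
        + (2 * κ) * (T k * (F (k + 1) - F k)) = e k * (κ * T k / e k + (F (k + 1) - F k)) ^ 2 := by
      field_simp
      ring
    have : 0 ≤ e k * (κ * T k / e k + (F (k + 1) - F k)) ^ 2 := by positivity
    linarith
  have total := sum_le_sum (s := range N) fun k _ => young k
  rw [sum_add_distrib, ← mul_sum, ← mul_sum, ← mul_sum] at total
  have hsq : ∑ k ∈ range (N + 1), ν k * F k ^ 2 = ∑ k ∈ range (N + 1), ν k * F k * F k :=
    sum_congr rfl fun k _ => by ring
  have hardy' := mul_le_mul_of_nonneg_left hardy hκ0.le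
  rw [hsq] at hardy' ⊢
  simp only [hT] at total
  rw [parts] at hardy' ⊢
  linarith

open Finset in
/-- Poincaré inequality on a finite path, with the variance cleared of denominators. -/
theorem path_poincare (ν e w A f : ℕ → ℝ) (κ : ℝ) (hκ0 : 0 < κ)
    (hν : ∀ k, 0 < ν k) (he : ∀ k, 0 < e k) (hw : ∀ k, 0 < w k)
    (hA0 : ν 0 * A 0 = e 0 * w 0)
    (hA : ∀ k, ν (k + 1) * A (k + 1) = e (k + 1) * w (k + 1) - e k * w k)
    (hκ : ∀ k, κ * w k ≤ A k - A (k + 1)) (N : ℕ) :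
    κ * ((∑ k ∈ range (N + 1), ν k) * ∑ k ∈ range (N + 1), ν k * f k ^ 2
        - (∑ k ∈ range (N + 1), ν k * f k) ^ 2)
      ≤ (∑ k ∈ range (N + 1), ν k) * ∑ k ∈ range N, e k * (f (k + 1) - f k) ^ 2 := by
  set Z := ∑ k ∈ range (N + 1), ν k with hZ
  set m := ∑ k ∈ range (N + 1), ν k * f k with hm
  have hZ0 : 0 < Z := sum_pos (fun k _ => hν k) (by simp)
  have hcent : ∑ k ∈ range (N + 1), ν k * (f k - m / Z) = 0 := by
    simp only [mul_sub, sum_sub_distrib]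
    rw [← sum_mul, ← hZ, ← hm]
    field_simp
    ring
  have h := path_poincare_centred ν e w A (fun k => f k - m / Z) κ hκ0 hν he hw hA0 hA hκ N hcent
  have hvar : ∑ k ∈ range (N + 1), ν k * (f k - m / Z) ^ 2
      = ∑ k ∈ range (N + 1), ν k * f k ^ 2 - m ^ 2 / Z := by
    have : ∀ k, ν k * (f k - m / Z) ^ 2
        = ν k * f k ^ 2 - 2 * (m / Z) * (ν k * f k) + (m / Z) ^ 2 * ν k := fun k => by ring
    simp only [this, sum_add_distrib, sum_sub_distrib, ← mul_sum]
    rw [← hZ, ← hm]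
    field_simp
    ring
  simp only [sub_sub_sub_cancel_right] at h
  rw [hvar] at h
  have h' := mul_le_mul_of_nonneg_left h hZ0.le
  have hZm : Z * (m ^ 2 / Z) = m ^ 2 := by field_simp
  calc _ = Z * (κ * (∑ k ∈ range (N + 1), ν k * f k ^ 2 - m ^ 2 / Z)) := by
        linear_combination κ * hZm
    _ ≤ _ := h'

open Finset Filter Topology in
/-- Poincaré inequality for a probability measure on `ℕ`, from a positive supersolution `w`
on the edges. -/
theorem nat_poincare (ν e w A f : ℕ → ℝ) (κ C : ℝ) (hκ0 : 0 < κ)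
    (hν : ∀ k, 0 < ν k) (he : ∀ k, 0 < e k) (hw : ∀ k, 0 < w k)
    (hA0 : ν 0 * A 0 = e 0 * w 0)
    (hA : ∀ k, ν (k + 1) * A (k + 1) = e (k + 1) * w (k + 1) - e k * w k)
    (hκ : ∀ k, κ * w k ≤ A k - A (k + 1))
    (heC : ∀ k, e k ≤ C * ν k) (heC' : ∀ k, e k ≤ C * ν (k + 1))
    (hsum : ∑' q, ν q = 1) (hf : Summable fun q => ν q * f q ^ 2) :
    ∑' q, ν q * (f q - ∑' p, ν p * f p) ^ 2
      ≤ 1 / κ * ∑' q, e q * (f (q + 1) - f q) ^ 2 := by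
  have hνs : Summable ν := by
    by_contra h
    rw [tsum_eq_zero_of_not_summable h] at hsum
    exact zero_ne_one hsum
  have hf1 : Summable fun q => ν q * f q := by
    refine Summable.of_norm_bounded (hνs.add hf) fun q => ?_
    rw [Real.norm_eq_abs, abs_mul, abs_of_pos (hν q)]
    have h1 : |f q| ≤ 1 + f q ^ 2 := by
      rw [← sq_abs]
      nlinarith [sq_nonneg (|f q| - 1), abs_nonneg (f q)]
    nlinarith [mul_le_mul_of_nonneg_left h1 (hν q).le]
  have hg : Summable fun q => e q * (f (q + 1) - f q) ^ 2 := by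
    have hf' := (summable_nat_add_iff 1).mpr hf
    refine Summable.of_nonneg_of_le (fun q => mul_nonneg (he q).le (sq_nonneg _)) (fun q => ?_)
      ((hf'.add hf).mul_left (2 * C))
    have h1 := mul_le_mul_of_nonneg_right (heC q) (sq_nonneg (f q))
    have h2 := mul_le_mul_of_nonneg_right (heC' q) (sq_nonneg (f (q + 1)))
    nlinarith [mul_nonneg (he q).le (sq_nonneg (f (q + 1) + f q))]
  have hvar : ∑' q, ν q * (f q - ∑' p, ν p * f p) ^ 2
      = ∑' q, ν q * f q ^ 2 - (∑' q, ν q * f q) ^ 2 := by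
    set m := ∑' q, ν q * f q with hm
    have h := ((hf.hasSum.sub (hf1.hasSum.mul_left (2 * m))).add (hνs.hasSum.mul_left (m ^ 2)))
    rw [hsum, ← hm] at h
    rw [show ∑' q, ν q * f q ^ 2 - m ^ 2 = ∑' q, ν q * f q ^ 2 - 2 * m * m + m ^ 2 * 1 by ring,
      ← h.tsum_eq]
    exact tsum_congr fun q => by ring
  have lim {a : ℕ → ℝ} (ha : Summable a) :
      Tendsto (fun N => ∑ k ∈ range (N + 1), a k) atTop (𝓝 (∑' q, a q)) :=
    (tendsto_add_atTop_iff_nat 1).mpr ha.hasSum.tendsto_sum_nat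
  have hlim := le_of_tendsto_of_tendsto'
    ((((lim hνs).mul (lim hf)).sub ((lim hf1).pow 2)).const_mul κ)
    ((lim hνs).mul hg.hasSum.tendsto_sum_nat)
    (path_poincare ν e w A f κ hκ0 hν he hw hA0 hA hκ)
  rw [hsum, one_mul, one_mul] at hlim
  rw [hvar, one_div, inv_mul_eq_div, le_div_iff₀ hκ0, mul_comm]
  exact hlim


/-- Poincaré inequality for the M/M/n queue with `λ = n − n^{1−α}` in the regime
`α ≥ 1` (Theorem 1 of the paper, case `α ≥ 1`): the Poincaré constant is
`1/(√n − √λ)²`. -/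
theorem mmn_poincare_alpha_ge_one
    (α : ℝ) (hα : 1 ≤ α) (n : ℕ) (hn : 2 ≤ n)
    (lam : ℝ) (hlam : lam = (n : ℝ) - (n : ℝ) ^ ((1 : ℝ) - α))
    (ν : ℕ → ℝ) (c : ℝ) (hc : 0 < c)
    (hν1 : ∀ q ≤ n, ν q = c * lam ^ q / (Nat.factorial q : ℝ))
    (hν2 : ∀ q > n, ν q = c * (lam ^ n / (Nat.factorial n : ℝ)) * (lam / n) ^ (q - n))
    (hνsum : ∑' q, ν q = 1) :
    ∀ f : ℕ → ℝ, (Summable fun q => ν q * f q ^ 2) →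
      (∑' q, ν q * (f q - ∑' p, ν p * f p) ^ 2)
        ≤ (1 / (Real.sqrt n - Real.sqrt lam) ^ 2)
            * ∑' q, lam * ν q * (f (q + 1) - f q) ^ 2 := by
  intro f hf
  have hn0 : (2 : ℝ) ≤ n := by exact_mod_cast hn
  have hδ0 : 0 < (n : ℝ) ^ ((1 : ℝ) - α) := Real.rpow_pos_of_pos (by linarith) _
  have hδ1 : (n : ℝ) ^ ((1 : ℝ) - α) ≤ 1 :=
    Real.rpow_le_one_of_one_le_of_nonpos (by linarith) (by linarith)
  have hlam1 : (n : ℝ) - 1 ≤ lam := by linarith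
  have hlamn : lam < n := by linarith
  have hlam0 : 0 < lam := by linarith
  clear hlam hδ0 hδ1
  set a := Real.sqrt n with ha
  set b := Real.sqrt lam with hb
  have ha2 : a * a = n := Real.mul_self_sqrt (by linarith)
  have hb2 : b * b = lam := Real.mul_self_sqrt hlam0.le
  have hb0 : 0 < b := Real.sqrt_pos.mpr hlam0
  have hba : b < a := Real.sqrt_lt_sqrt hlam0.le hlamn
  have ha0 : 0 < a := hb0.trans hba
  have hab : (n : ℝ) - 1 ≤ a * b := by nlinarith
  have hν : ∀ k, 0 < ν k := by
    intro k
    rcases le_or_gt k n with h | h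
    · rw [hν1 k h]; positivity
    · rw [hν2 k h]; positivity
  have hbal : ∀ k, ((min (k + 1) n : ℕ) : ℝ) * ν (k + 1) = lam * ν k := by
    intro k
    rcases lt_trichotomy k n with h | h | h
    · rw [hν1 k h.le, hν1 (k + 1) h, min_eq_left h, Nat.factorial_succ]
      push_cast
      field_simp
      ring
    · subst h
      rw [hν1 k le_rfl, hν2 (k + 1) (by omega), min_eq_right (by omega), Nat.add_sub_cancel_left]
      field_simp
    · rw [hν2 k h, hν2 (k + 1) (by omega), min_eq_right (by omega),
        show k + 1 - n = (k - n) + 1 by omega, pow_succ]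
      field_simp
  have hs0 : 0 < a / b := div_pos ha0 hb0
  refine nat_poincare ν (fun q => lam * ν q) (fun k => (a / b) ^ (k + 1 - n))
    (fun k => lam * (a / b) ^ (k + 1 - n) - ((min k n : ℕ) : ℝ) * (a / b) ^ (k - n)) f
    ((a - b) ^ 2) n (by have := sub_pos.mpr hba; positivity) hν (fun k => mul_pos hlam0 (hν k))
    (fun k => pow_pos hs0 _) ?_ ?_ ?_ ?_ ?_ hνsum hf
  · simp only [Nat.zero_min, Nat.cast_zero, zero_mul, sub_zero]
    ring
  · intro k
    linear_combination -(a / b) ^ (k + 1 - n) * hbal k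
  · intro k
    rcases lt_trichotomy (k + 1) n with h | h | h
    · rw [show k + 1 - n = 0 by omega, show k + 1 + 1 - n = 0 by omega, show k - n = 0 by omega,
        min_eq_left h.le, min_eq_left (by omega : k ≤ n)]
      push_cast
      nlinarith
    · rw [show k + 1 - n = 0 by omega, show k + 1 + 1 - n = 1 by omega, show k - n = 0 by omega,
        min_eq_left h.le, min_eq_left (by omega : k ≤ n), h]
      have hk : (k : ℝ) = n - 1 := by rw [← h]; push_cast; ring
      have hls : lam * (a / b) = a * b := by rw [← hb2]; field_simp
      rw [hk, pow_zero, pow_one, hls]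
      nlinarith
    · obtain ⟨j, rfl⟩ : ∃ j, k = n + j := ⟨k - n, by omega⟩
      rw [show n + j + 1 - n = j + 1 by omega, show n + j + 1 + 1 - n = j + 1 + 1 by omega,
        show n + j - n = j by omega, min_eq_right (by omega), min_eq_right (by omega),
        ← ha2, ← hb2]
      apply le_of_eq
      simp only [pow_succ]
      field_simp
      ring
  · intro k
    exact mul_le_mul_of_nonneg_right hlamn.le (hν k).le
  · intro k
    rw [← hbal k]
    exact mul_le_mul_of_nonneg_right (by exact_mod_cast min_le_right _ _) (hν (k + 1)).le
end

section
/- Let n ≥ 2 and λ be integers with 1 ≤ λ < n, let L be the M/M/n generator with arrival rate λ, let θ = log(1 + 1/(n−λ)), and define V : ℕ → ℝ by V(q) = |q − λ| for q ≤ n and V(q) = (n−λ)·e^{θ·(q−n)} for q > n. Then: (i) (L V)(q) = −V(q) for every q ≤ n with q ≠ λ; (ii) (L V)(λ) = 2λ; and (iii) (L V)(q) = −(1 − n/((n−λ)·(n−λ+1)))·V(q) for every q > n. In particular, with γ = 1 − n/((n−λ)·(n−λ+1)), one has (L V)(q) ≤ −γ·V(q) + 2λ·1_{q=λ} for all q ∈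 ℕ. -/
/-- Drift computation for the M/M/n queue with integer arrival rate `λ`
(Lemma 3 of the paper, integer case): with `θ = log(1 + 1/(n−λ))`,
`V(q) = |q−λ|` for `q ≤ n` and `V(q) = (n−λ)·e^{θ(q−n)}` for `q > n`. -/
theorem mmn_drift_lemma_integer_rate
    (n lam : ℕ) (hn : 2 ≤ n) (hlam1 : 1 ≤ lam) (hlam2 : lam < n)
    (θ : ℝ) (hθ : θ = Real.log (1 + 1 / ((n : ℝ) - lam)))
    (V : ℕ → ℝ)
    (hV1 : ∀ q ≤ n, V q = |(q : ℝ) - (lam : ℝ)|)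
    (hV2 : ∀ q > n, V q = ((n : ℝ) - lam) * Real.exp (θ * ((q : ℝ) - n)))
    (LV : ℕ → ℝ)
    (hLV : ∀ q : ℕ,
      LV q = (lam : ℝ) * (V (q + 1) - V q) + (min q n : ℝ) * (V (q - 1) - V q)) :
    (∀ q ≤ n, q ≠ lam → LV q = -V q) ∧
    (LV lam = 2 * (lam : ℝ)) ∧
    (∀ q > n,
      LV q = -(1 - (n : ℝ) / (((n : ℝ) - lam) * ((n : ℝ) - lam + 1))) * V q) ∧
    (∀ q : ℕ,
      LV q ≤ -(1 - (n : ℝ) / (((n : ℝ) - lam) * ((n : ℝ) - lam + 1))) * V q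
        + 2 * (lam : ℝ) * (if q = lam then 1 else 0)) := by
  have hd : (0 : ℝ) < (n : ℝ) - lam := by
    have : (lam : ℝ) < n := by exact_mod_cast hlam2
    linarith
  have hexp : Real.exp θ = 1 + 1 / ((n : ℝ) - lam) := by
    rw [hθ, Real.exp_log (by positivity)]
  -- the exponential branch also describes `V n`, and `|q - lam|` also describes `V (n + 1)`
  have hgeom : ∀ k : ℕ, V (n + k) = ((n : ℝ) - lam) * (1 + 1 / ((n : ℝ) - lam)) ^ k := by
    intro k
    rcases Nat.eq_zero_or_pos k with rfl | hk
    · simp [hV1 n le_rfl, abs_of_pos hd]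
    · rw [hV2 (n + k) (by omega), ← hexp, ← Real.exp_nat_mul]
      push_cast
      ring_nf
  have habs : ∀ q ≤ n + 1, V q = |(q : ℝ) - lam| := by
    intro q hq
    rcases Nat.le_succ_iff.mp hq with h | rfl
    · exact hV1 q h
    · rw [Nat.succ_eq_add_one, hgeom 1, abs_of_pos (by push_cast; linarith)]
      push_cast
      field_simp
      ring
  have hbelow : ∀ q ≤ n, q ≠ lam → LV q = -V q := by
    intro q hq hne
    have hqn : (q : ℝ) ≤ n := by exact_mod_cast hq
    rw [hLV, min_eq_left hqn, habs (q + 1) (by omega), habs q (by omega),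
      habs (q - 1) (by omega)]
    rcases lt_or_gt_of_ne hne with h | h
    · have h1 : (q : ℝ) + 1 ≤ lam := by exact_mod_cast h
      rcases Nat.eq_zero_or_pos q with rfl | hpos
      · push_cast at h1 ⊢
        rw [abs_of_nonpos (by linarith), abs_of_nonpos (by linarith)]
        ring
      · push_cast [Nat.cast_sub hpos]
        rw [abs_of_nonpos (by linarith), abs_of_nonpos (by linarith),
          abs_of_nonpos (by linarith)]
        ring
    · have h1 : (lam : ℝ) + 1 ≤ q := by exact_mod_cast h
      have hpos : 1 ≤ q := by omega
      push_cast [Nat.cast_sub hpos]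
      rw [abs_of_nonneg (by linarith), abs_of_nonneg (by linarith),
        abs_of_nonneg (by linarith)]
      ring
  have hcenter : LV lam = 2 * (lam : ℝ) := by
    rw [hLV, min_eq_left (by linarith), habs (lam + 1) (by omega), habs lam (by omega),
      habs (lam - 1) (by omega)]
    push_cast [Nat.cast_sub hlam1]
    simp
    ring
  have habove : ∀ q > n,
      LV q = -(1 - (n : ℝ) / (((n : ℝ) - lam) * ((n : ℝ) - lam + 1))) * V q := by
    intro q hq
    obtain ⟨k, rfl⟩ := Nat.exists_eq_add_of_lt hq
    have hmin : (n : ℝ) ≤ ((n + k + 1 : ℕ) : ℝ) := by exact_mod_cast hq.le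
    rw [hLV, min_eq_right hmin, Nat.add_sub_cancel, hgeom k, add_assoc n k 1, hgeom (k + 1),
      add_assoc n (k + 1) 1, hgeom (k + 1 + 1), pow_succ, pow_succ]
    generalize (1 + 1 / ((n : ℝ) - lam)) ^ k = x
    obtain ⟨d, hdeq⟩ : ∃ d : ℝ, d = (n : ℝ) - lam := ⟨_, rfl⟩
    have hl : (lam : ℝ) = n - d := by linarith
    rw [← hdeq] at hd ⊢
    rw [hl]
    have hd1 : d + 1 ≠ 0 := by positivity
    field_simp
    ring
  refine ⟨hbelow, hcenter, habove, fun q => ?_⟩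
  by_cases hql : q = lam
  · subst hql
    rw [hcenter, hV1 q hlam2.le]
    simp
  · rw [if_neg hql, mul_zero, add_zero]
    rcases le_or_gt q n with hq | hq
    · rw [hbelow q hq hql]
      have hV : 0 ≤ V q := by rw [hV1 q hq]; exact abs_nonneg _
      have hfrac : 0 ≤ (n : ℝ) / (((n : ℝ) - lam) * ((n : ℝ) - lam + 1)) := by positivity
      nlinarith [mul_nonneg hfrac hV]
    · exact (habove q hq).le
end

section
/- Let n ≥ 1 be an integer, let 0 < λ < n, let z ∈ (1, n/λ), and define V : ℕ → ℝ by V(q) = 1 for q < n and V(q) = z^{q−n} for q ≥ n. Let L be the M/M/n generator with arrival rate λ, and set γ = λ·(z−1)·(n/(λz) − 1) and B = γ + λ·(z−1). Then γ > 0 and: (i) (L V)(q) = −γ·V(q) for every q > n; (ii) (L V)(q) = 0 for every q < n; (iii) (L V)(n) = λ·(z−1); and consequently (L V)(q) ≤ −γ·V(q) + B·1_{q ≤ n} for all q ∈ ℕ. -/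
/-- Drift computation for the M/M/n queue in the Mean Field regime
(Lemma 8 of the paper): with `V(q) = 1` for `q < n`, `V(q) = z^{q−n}` for `q ≥ n`,
`γ = λ(z−1)(n/(λz) − 1)` and `B = γ + λ(z−1)`, one has the stated identities and
`L V(q) ≤ −γ V(q) + B·1_{q ≤ n}`. -/
theorem mmn_drift_lemma_mean_field
    (n : ℕ) (hn : 1 ≤ n) (lam : ℝ) (hlam0 : 0 < lam) (hlamn : lam < n)
    (z : ℝ) (hz1 : 1 < z) (hz2 : z < (n : ℝ) / lam)
    (V : ℕ → ℝ)
    (hV1 : ∀ q < n, V q = 1)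
    (hV2 : ∀ q, n ≤ q → V q = z ^ (q - n))
    (LV : ℕ → ℝ)
    (hLV : ∀ q : ℕ,
      LV q = lam * (V (q + 1) - V q) + (min q n : ℝ) * (V (q - 1) - V q))
    (γ B : ℝ)
    (hγdef : γ = lam * (z - 1) * ((n : ℝ) / (lam * z) - 1))
    (hBdef : B = γ + lam * (z - 1)) :
    0 < γ ∧
    (∀ q, n < q → LV q = -γ * V q) ∧
    (∀ q, q < n → LV q = 0) ∧
    (LV n = lam * (z - 1)) ∧
    (∀ q : ℕ, LV q ≤ -γ * V q + B * (if q ≤ n then 1 else 0)) := by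
  have hz0 : 0 < z := by linarith
  have hlz : lam * z < n := by
    rw [lt_div_iff₀ hlam0] at hz2
    linarith
  have hV1' : ∀ q ≤ n, V q = 1 := fun q hq => by
    rcases hq.lt_or_eq with h | rfl
    · exact hV1 q h
    · simp [hV2 q le_rfl]
  have hγ : 0 < γ := by
    rw [hγdef]
    have h : 1 < (n : ℝ) / (lam * z) := (one_lt_div (by positivity)).2 hlz
    exact mul_pos (mul_pos hlam0 (by linarith)) (by linarith)
  have habove : ∀ q, n < q → LV q = -γ * V q := fun q hq => by
    obtain ⟨k, rfl⟩ := Nat.exists_eq_add_of_lt hq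
    have hmin : min ((n + k + 1 : ℕ) : ℝ) (n : ℝ) = n :=
      min_eq_right (by exact_mod_cast hq.le)
    rw [hLV, hmin, hV2 _ (by omega), hV2 (n + k + 1) (by omega), hV2 _ (by omega),
      show n + k + 1 + 1 - n = k + 2 by omega, show n + k + 1 - n = k + 1 by omega,
      show n + k + 1 - 1 - n = k by omega, hγdef]
    field_simp
    ring
  have hbelow : ∀ q, q < n → LV q = 0 := fun q hq => by
    rw [hLV, hV1' (q + 1) hq, hV1' q hq.le, hV1' (q - 1) (by omega)]
    ring
  have hat : LV n = lam * (z - 1) := by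
    rw [hLV, hV1' n le_rfl, hV1' (n - 1) (by omega), hV2 (n + 1) (by omega),
      Nat.add_sub_cancel_left]
    ring
  refine ⟨hγ, habove, hbelow, hat, fun q => ?_⟩
  rcases lt_trichotomy q n with h | rfl | h
  · rw [hbelow q h, hV1 q h, if_pos h.le, hBdef]
    have : 0 < lam * (z - 1) := mul_pos hlam0 (by linarith)
    linarith
  · rw [hat, hV1' q le_rfl, if_pos le_rfl, hBdef]
    linarith
  · rw [habove q h, if_neg h.not_ge]
    linarith
end

section
/- (Truncated Poisson Poincaré inequality / truncated M/M/n) Let λ > 0 and let n ≥ 0 be an integer. Let μ be the Poisson(λ) distribution truncated to K = {0, 1, …, n}, i.e. μ(x) = (λ^x/x!)/(Σ_{y=0}^{n} λ^y/y!) for 0 ≤ x ≤ n. Then for every f : K → ℝ: Σ_{x=0}^{n} μ(x)·(f(x) − Σ_{y=0}^{n} μ(y)f(y))² ≤ Σ_{x=0}^{n−1} μ(x)·λ·(f(x+1) − f(x))². -/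
/-- The variance, in unnormalized form, after adding one point of mass `v` to a measure of
total mass `Z`. -/
lemma variance_add_point {Z v : ℝ} (hZ : 0 < Z) (hv : 0 < v) (Q S y : ℝ) :
    Q + v * y ^ 2 - (S + v * y) ^ 2 / (Z + v)
      = Q - S ^ 2 / Z + v * (Z * y - S) ^ 2 / (Z * (Z + v)) := by
  have : Z + v ≠ 0 := by positivity
  field_simp
  ring

/-- Cauchy–Schwarz in Engel form with weights `D` and `Z`, allowing `D = 0` when `b = 0`. -/
lemma sq_div_add_le {Z D b e : ℝ} (hZ : 0 < Z) (hD : 0 ≤ D) (hb : D = 0 → b = 0) :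
    (b + e) ^ 2 / (D + Z) ≤ b ^ 2 / D + e ^ 2 / Z := by
  rcases hD.eq_or_lt with h | h
  · simp [← h, hb h.symm]
  · rw [div_add_div _ _ h.ne' hZ.ne', div_le_div_iff₀ (by positivity) (by positivity)]
    nlinarith [sq_nonneg (b * Z - e * D)]

/-- Poisson weights satisfy the detailed balance relation. -/
lemma poisson_weight_succ (lam : ℝ) (n : ℕ) :
    lam ^ (n + 1) / ((n + 1).factorial : ℝ)
      = lam * (lam ^ n / (n.factorial : ℝ)) / ((n : ℝ) + 1) := by
  rw [Nat.factorial_succ]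
  have : (n.factorial : ℝ) ≠ 0 := by positivity
  push_cast
  field_simp
  ring

/-- A Poincaré inequality for unnormalized truncated Poisson weights `w`, with an additional
boundary term at the right end point, for which linear functions are extremal. -/
lemma poincare_with_boundary_term (lam : ℝ) (hlam : 0 < lam) (w : ℕ → ℝ) (hw : ∀ n, 0 < w n)
    (hsucc : ∀ n : ℕ, w (n + 1) = lam * w n / ((n : ℝ) + 1)) (f : ℕ → ℝ) (n : ℕ) :
    let Z := ∑ x ∈ Finset.range (n + 1), w x
    let S := ∑ x ∈ Finset.range (n + 1), w x * f x
    let D := (n - lam) * Z + lam * w n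
    0 ≤ D ∧ (D = 0 → Z * f n - S = 0) ∧
      (∑ x ∈ Finset.range (n + 1), w x * f x ^ 2) - S ^ 2 / Z
          + lam * w n / Z * ((Z * f n - S) ^ 2 / D)
        ≤ ∑ x ∈ Finset.range n, w x * lam * (f (x + 1) - f x) ^ 2 := by
  induction n with
  | zero =>
    have := (hw 0).ne'
    refine ⟨by simp, by simp, ?_⟩
    simp only [zero_add, Finset.sum_range_one, Finset.sum_range_zero, sub_self, ne_eq,
      OfNat.ofNat_ne_zero, not_false_eq_true, zero_pow, zero_div, mul_zero, add_zero]
    apply le_of_eq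
    field_simp
    ring
  | succ n ih =>
    have hZpos : 0 < ∑ x ∈ Finset.range (n + 1), w x :=
      Finset.sum_pos (fun i _ => hw i) (by simp)
    dsimp only at ih ⊢
    rw [Finset.sum_range_succ w (n + 1), Finset.sum_range_succ (fun x => w x * f x) (n + 1),
      Finset.sum_range_succ (fun x => w x * f x ^ 2) (n + 1),
      Finset.sum_range_succ (fun x => w x * lam * (f (x + 1) - f x) ^ 2) n]
    set Z := ∑ x ∈ Finset.range (n + 1), w x
    set S := ∑ x ∈ Finset.range (n + 1), w x * f x
    set Q := ∑ x ∈ Finset.range (n + 1), w x * f x ^ 2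
    obtain ⟨hD, hb, hle⟩ := ih
    set D := ((n : ℝ) - lam) * Z + lam * w n
    have hv := hw (n + 1)
    have hbal : ((n : ℝ) + 1) * w (n + 1) = lam * w n := by
      rw [hsucc]; field_simp
    have hD' : (((n + 1 : ℕ) : ℝ) - lam) * (Z + w (n + 1)) + lam * w (n + 1) = D + Z := by
      push_cast
      linear_combination hbal
    have hDZ : 0 < D + Z := by positivity
    rw [hD', variance_add_point hZpos hv]
    have hnum : (Z + w (n + 1)) * f (n + 1) - (S + w (n + 1) * f (n + 1))
        = Z * f (n + 1) - S := by ring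
    rw [hnum]
    refine ⟨hDZ.le, fun h => absurd h hDZ.ne', ?_⟩
    have hcoef : w (n + 1) * (Z * f (n + 1) - S) ^ 2 / (Z * (Z + w (n + 1)))
          + lam * w (n + 1) / (Z + w (n + 1)) * ((Z * f (n + 1) - S) ^ 2 / (D + Z))
        = lam * w n / Z * ((Z * f (n + 1) - S) ^ 2 / (D + Z)) := by
      have h1 : D + Z + lam * Z = ((n : ℝ) + 1) * (Z + w (n + 1)) := by
        linear_combination -hbal
      have : Z + w (n + 1) ≠ 0 := by positivity
      rw [← hbal]
      field_simp
      linear_combination (Z * f (n + 1) - S) ^ 2 * h1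
    have hcs := sq_div_add_le (e := Z * (f (n + 1) - f n)) hZpos hD hb
    have hsum : Z * f n - S + Z * (f (n + 1) - f n) = Z * f (n + 1) - S := by ring
    rw [hsum] at hcs
    have hpos : 0 ≤ lam * w n / Z := by have := hw n; positivity
    have hmul := mul_le_mul_of_nonneg_left hcs hpos
    have hlast : lam * w n / Z * ((Z * (f (n + 1) - f n)) ^ 2 / Z)
        = w n * lam * (f (n + 1) - f n) ^ 2 := by
      field_simp
    rw [mul_add, hlast] at hmul
    linarith

/-- Truncated Poisson Poincaré inequality / truncated M/M/n (Lemma 9 of the paper):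
the Poisson(λ) distribution truncated to `{0, …, n}` satisfies the Poincaré
inequality with constant `1` for the truncated M/M/n Dirichlet form. -/
theorem truncated_poisson_poincare
    (lam : ℝ) (hlam : 0 < lam) (n : ℕ)
    (μ : ℕ → ℝ)
    (hμ : ∀ x ≤ n,
      μ x = (lam ^ x / (Nat.factorial x : ℝ))
        / ∑ y ∈ Finset.range (n + 1), lam ^ y / (Nat.factorial y : ℝ)) :
    ∀ f : ℕ → ℝ,
      (∑ x ∈ Finset.range (n + 1),
          μ x * (f x - ∑ y ∈ Finset.range (n + 1), μ y * f y) ^ 2)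
        ≤ ∑ x ∈ Finset.range n, μ x * lam * (f (x + 1) - f x) ^ 2 := by
  intro f
  set w : ℕ → ℝ := fun x => lam ^ x / (Nat.factorial x : ℝ)
  have hw : ∀ x, 0 < w x := fun x => by positivity
  have hZ : 0 < ∑ x ∈ Finset.range (n + 1), w x :=
    Finset.sum_pos (fun i _ => hw i) (by simp)
  obtain ⟨hD, -, hle⟩ :=
    poincare_with_boundary_term lam hlam w hw (poisson_weight_succ lam) f n
  have hboundary := mul_nonneg (div_nonneg (mul_nonneg hlam.le (hw n).le) hZ.le)
    (div_nonneg (sq_nonneg ((∑ x ∈ Finset.range (n + 1), w x) * f n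
      - ∑ x ∈ Finset.range (n + 1), w x * f x)) hD)
  have hsum : ∀ g : ℕ → ℝ, ∑ x ∈ Finset.range (n + 1), μ x * g x
      = (∑ x ∈ Finset.range (n + 1), w x * g x) / ∑ x ∈ Finset.range (n + 1), w x := by
    intro g
    rw [Finset.sum_div]
    refine Finset.sum_congr rfl fun x hx => ?_
    rw [hμ x (Nat.lt_succ_iff.mp (Finset.mem_range.mp hx)), div_mul_eq_mul_div]
  have hright : ∑ x ∈ Finset.range n, μ x * lam * (f (x + 1) - f x) ^ 2
      = (∑ x ∈ Finset.range n, w x * lam * (f (x + 1) - f x) ^ 2)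
        / ∑ x ∈ Finset.range (n + 1), w x := by
    rw [Finset.sum_div]
    refine Finset.sum_congr rfl fun x hx => ?_
    rw [hμ x (Finset.mem_range.mp hx).le]
    ring
  have hvar : ∀ c : ℝ, ∑ x ∈ Finset.range (n + 1), w x * (f x - c) ^ 2
      = (∑ x ∈ Finset.range (n + 1), w x * f x ^ 2)
        - 2 * c * (∑ x ∈ Finset.range (n + 1), w x * f x)
        + c ^ 2 * ∑ x ∈ Finset.range (n + 1), w x := by
    intro c
    rw [Finset.mul_sum, Finset.mul_sum, ← Finset.sum_sub_distrib, ← Finset.sum_add_distrib]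
    exact Finset.sum_congr rfl fun x _ => by ring
  rw [hright, hsum f, hsum fun x => (f x - _) ^ 2, hvar]
  refine div_le_div_of_nonneg_right ?_ hZ.le
  refine le_trans (le_of_eq ?_) ((le_add_of_nonneg_right hboundary).trans hle)
  field_simp
  ring
end

section
/- Let α > 0 be real, let n ≥ 2 be an integer, let λ = n − n^{1−α} (so 0 < λ < n), and let ν_n be the stationary distribution of the M/M/n queue with arrival rate λ and unit service rate. Then the variance of the queue length under ν_n satisfies Σ_q ν_n(q)·q² − (Σ_q ν_n(q)·q)² ≤ 2·(n^α + n)². -/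
theorem tsum_sq_mul_geometric_le {r : ℝ} (h0 : 0 ≤ r) (h1 : r < 1) :
    ∑' k : ℕ, (k : ℝ) ^ 2 * r ^ k ≤ 2 * ((1 - r)⁻¹) ^ 3 := by
  have hr : ‖r‖ < 1 := by rwa [Real.norm_of_nonneg h0]
  have hc := (hasSum_choose_mul_geometric_of_norm_lt_one 2 hr).mul_left 2
  have hle : ∀ k : ℕ, (k : ℝ) ^ 2 * r ^ k ≤ 2 * (((k + 2).choose 2 : ℕ) * r ^ k) := by
    intro k
    have hk : (k : ℝ) ^ 2 ≤ 2 * ((k + 2).choose 2 : ℕ) := by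
      rw [Nat.cast_choose_two]
      push_cast
      nlinarith [(Nat.cast_nonneg k : (0 : ℝ) ≤ k)]
    calc (k : ℝ) ^ 2 * r ^ k ≤ (2 * ((k + 2).choose 2 : ℕ)) * r ^ k := by gcongr
      _ = _ := by ring
  have := (summable_pow_mul_geometric_of_norm_lt_one 2 hr).tsum_le_tsum hle hc.summable
  rw [hc.tsum_eq] at this
  refine this.trans_eq ?_
  norm_num

/-- A probability sequence with a geometric tail of ratio `r` from `n` on has variance at most
`n ^ 2 + 2 * (1 - r)⁻¹ ^ 2`. -/
theorem variance_le_of_geometric_tail {ν : ℕ → ℝ} {n : ℕ} {r : ℝ} (h0 : 0 ≤ r) (h1 : r < 1)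
    (hν : ∀ q, 0 ≤ ν q) (htail : ∀ k, ν (k + n) = ν n * r ^ k) (hsum : ∑' q, ν q = 1) :
    (∑' q, ν q * (q : ℝ) ^ 2) - (∑' q, ν q * (q : ℝ)) ^ 2
      ≤ (n : ℝ) ^ 2 + 2 * ((1 - r)⁻¹) ^ 2 := by
  have hr : ‖r‖ < 1 := by rwa [Real.norm_of_nonneg h0]
  have g0 := summable_geometric_of_lt_one h0 h1
  have g1 := summable_pow_mul_geometric_of_norm_lt_one 1 hr
  have g2 := summable_pow_mul_geometric_of_norm_lt_one 2 hr
  have s0 : Summable ν := (summable_nat_add_iff n).1 <| by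
    simpa only [htail] using g0.mul_left (ν n)
  have s1 : Summable fun q => ν q * (q : ℝ) := (summable_nat_add_iff n).1 <| by
    refine ((g1.add (g0.mul_left (n : ℝ))).mul_left (ν n)).congr fun k => ?_
    rw [htail]; push_cast; ring
  have s2 : Summable fun q => ν q * (q : ℝ) ^ 2 := (summable_nat_add_iff n).1 <| by
    refine (((g2.add (g1.mul_left (2 * n : ℝ))).add
      (g0.mul_left ((n : ℝ) ^ 2))).mul_left (ν n)).congr fun k => ?_
    rw [htail]; push_cast; ring
  have hs : HasSum (fun q => ν q * ((q : ℝ) - n) ^ 2)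
      ((∑' q, ν q * (q : ℝ) ^ 2) - 2 * n * (∑' q, ν q * (q : ℝ)) + (n : ℝ) ^ 2 * 1) := by
    have h := (s2.hasSum.sub (s1.hasSum.mul_left (2 * n : ℝ))).add
      (s0.hasSum.mul_left ((n : ℝ) ^ 2))
    rw [hsum] at h
    refine h.congr_fun fun q => ?_
    ring
  have hsplit := hs.summable.sum_add_tsum_nat_add n
  have hsplit0 := s0.sum_add_tsum_nat_add n
  have htail2 : ∑' k : ℕ, ν (k + n) * (((k + n : ℕ) : ℝ) - n) ^ 2
      = ν n * ∑' k : ℕ, (k : ℝ) ^ 2 * r ^ k := by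
    rw [← tsum_mul_left]
    refine tsum_congr fun k => ?_
    rw [htail]; push_cast; ring
  have htail0 : ∑' k : ℕ, ν (k + n) = ν n * (1 - r)⁻¹ := by
    simp only [htail]
    rw [tsum_mul_left, tsum_geometric_of_lt_one h0 h1]
  rw [hs.tsum_eq, htail2] at hsplit
  rw [hsum, htail0] at hsplit0
  have hinv : 0 ≤ (1 - r)⁻¹ := inv_nonneg.2 (by linarith)
  have hhead : ∑ q ∈ Finset.range n, ν q * ((q : ℝ) - n) ^ 2
      ≤ (n : ℝ) ^ 2 * ∑ q ∈ Finset.range n, ν q := by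
    rw [Finset.mul_sum]
    refine Finset.sum_le_sum fun q hq => ?_
    have hqn : (q : ℝ) ≤ n := by exact_mod_cast (Finset.mem_range.1 hq).le
    have : ((q : ℝ) - n) ^ 2 ≤ (n : ℝ) ^ 2 := by nlinarith [(Nat.cast_nonneg q : (0 : ℝ) ≤ q)]
    rw [mul_comm]
    exact mul_le_mul_of_nonneg_right this (hν q)
  have hheadnn : 0 ≤ ∑ q ∈ Finset.range n, ν q := Finset.sum_nonneg fun q _ => hν q
  have hp : ν n * (1 - r)⁻¹ ≤ 1 := by linarith
  have hp0 : 0 ≤ ν n * (1 - r)⁻¹ := mul_nonneg (hν n) hinv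
  have hA : (n : ℝ) ^ 2 * ∑ q ∈ Finset.range n, ν q ≤ (n : ℝ) ^ 2 :=
    mul_le_of_le_one_right (sq_nonneg _) (by linarith)
  have hB : ν n * ∑' k : ℕ, (k : ℝ) ^ 2 * r ^ k ≤ 2 * ((1 - r)⁻¹) ^ 2 := by
    calc ν n * ∑' k : ℕ, (k : ℝ) ^ 2 * r ^ k ≤ ν n * (2 * ((1 - r)⁻¹) ^ 3) :=
          mul_le_mul_of_nonneg_left (tsum_sq_mul_geometric_le h0 h1) (hν n)
      _ = (ν n * (1 - r)⁻¹) * (2 * ((1 - r)⁻¹) ^ 2) := by ring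
      _ ≤ _ := mul_le_of_le_one_left (by positivity) hp
  nlinarith [sq_nonneg ((∑' q, ν q * (q : ℝ)) - n)]


/-- Variance bound for the stationary queue length of the M/M/n queue with
`λ = n − n^{1−α}` (Lemma 11 of the paper): `Var_{ν_n}(q) ≤ 2·(n^α + n)²`. -/
theorem mmn_stationary_variance_bound
    (α : ℝ) (hα : 0 < α) (n : ℕ) (hn : 2 ≤ n)
    (lam : ℝ) (hlam : lam = (n : ℝ) - (n : ℝ) ^ ((1 : ℝ) - α))
    (ν : ℕ → ℝ) (c : ℝ) (hc : 0 < c)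
    (hν1 : ∀ q ≤ n, ν q = c * lam ^ q / (Nat.factorial q : ℝ))
    (hν2 : ∀ q > n, ν q = c * (lam ^ n / (Nat.factorial n : ℝ)) * (lam / n) ^ (q - n))
    (hνsum : ∑' q, ν q = 1) :
    (∑' q, ν q * (q : ℝ) ^ 2) - (∑' q, ν q * (q : ℝ)) ^ 2
      ≤ 2 * ((n : ℝ) ^ α + n) ^ 2 := by
  have hn0 : (0 : ℝ) < n := by positivity
  have hn1 : (1 : ℝ) < n := by exact_mod_cast hn
  set m : ℝ := (n : ℝ) ^ α with hm
  have hm1 : 1 < m := Real.one_lt_rpow hn1 hα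
  have hm0 : 0 < m := by linarith
  have hr : lam / n = 1 - m⁻¹ := by
    rw [hlam, Real.rpow_sub hn0, Real.rpow_one, ← hm]
    field_simp
  have hminv : m⁻¹ < 1 := inv_lt_one_of_one_lt₀ hm1
  have h0 : 0 ≤ lam / n := by rw [hr]; linarith
  have h1 : lam / n < 1 := by rw [hr]; linarith [inv_pos.2 hm0]
  have hlam0 : 0 ≤ lam := by
    have := mul_nonneg h0 hn0.le
    rwa [div_mul_cancel₀ _ hn0.ne'] at this
  have hν : ∀ q, 0 ≤ ν q := by
    intro q
    rcases le_or_gt q n with h | h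
    · rw [hν1 q h]; positivity
    · rw [hν2 q h]; positivity
  have htail : ∀ k, ν (k + n) = ν n * (lam / n) ^ k := by
    intro k
    rcases Nat.eq_zero_or_pos k with rfl | hk
    · simp
    · rw [hν2 (k + n) (by omega), hν1 n le_rfl, Nat.add_sub_cancel]
      ring
  have hvar := variance_le_of_geometric_tail h0 h1 hν htail hνsum
  rw [hr, sub_sub_cancel, inv_inv] at hvar
  nlinarith [mul_pos hm0 hn0, sq_nonneg (n : ℝ)]
end

section
/- Let α > 0 and δ > 0 be real numbers, let n be an integer with n ≥ max{65, 2^{1/α}}, let λ = n − n^{1−α}, let ε = 1 − λ/n = n^{−α}, and let ν_n be the stationary distribution of the M/M/n queue with arrival rate λ and unit service rate. Then the moment generating function of the centered queue length satisfies Σ_q ν_n(q)·e^{ε·(q−n)/(1+δ)} ≤ 1 + 1/δ. -/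
/-- The geometric ratio `(1 - x)` tilted by `exp t` stays below `1 - x + t` when `t ≤ x < 1`. -/
theorem one_sub_mul_exp_le {x t : ℝ} (htx : t ≤ x) (hx : x < 1) (ht : 0 ≤ t) :
    (1 - x) * Real.exp t ≤ 1 - x + t := by
  have h1 : Real.exp t * (1 - t) ≤ 1 := by
    have h := Real.one_sub_le_exp_neg t
    calc Real.exp t * (1 - t) ≤ Real.exp t * Real.exp (-t) := by gcongr
      _ = 1 := by rw [← Real.exp_add]; simp
  have h2 : 0 < 1 - t := by linarith
  refine le_of_mul_le_mul_right ?_ h2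
  nlinarith [mul_le_mul_of_nonneg_left h1 (by linarith : 0 ≤ 1 - x),
    mul_nonneg ht (sub_nonneg.2 htx)]


/-- MGF bound for the centered stationary queue length of the M/M/n queue
(Lemma 12 of the paper): for `n ≥ max{65, 2^{1/α}}`, `λ = n − n^{1−α}` and
`ε = 1 − λ/n`, `E_{ν_n}[e^{ε(q−n)/(1+δ)}] ≤ 1 + 1/δ`. -/
theorem mmn_stationary_mgf_bound
    (α δ : ℝ) (hα : 0 < α) (hδ : 0 < δ)
    (n : ℕ) (hn65 : 65 ≤ n) (hn2 : (2 : ℝ) ^ ((1 : ℝ) / α) ≤ (n : ℝ))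
    (lam : ℝ) (hlam : lam = (n : ℝ) - (n : ℝ) ^ ((1 : ℝ) - α))
    (ε : ℝ) (hε : ε = 1 - lam / n)
    (ν : ℕ → ℝ) (c : ℝ) (hc : 0 < c)
    (hν1 : ∀ q ≤ n, ν q = c * lam ^ q / (Nat.factorial q : ℝ))
    (hν2 : ∀ q > n, ν q = c * (lam ^ n / (Nat.factorial n : ℝ)) * (lam / n) ^ (q - n))
    (hνsum : ∑' q, ν q = 1) :
    (∑' q, ν q * Real.exp (ε * ((q : ℝ) - n) / (1 + δ))) ≤ 1 + 1 / δ := by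
  have hn0 : (0 : ℝ) < n := by exact_mod_cast (by omega : 0 < n)
  have hn1 : (1 : ℝ) < n := by exact_mod_cast (by omega : 1 < n)
  have hε' : ε = (n : ℝ) ^ (-α) := by
    rw [hε, hlam, sub_eq_add_neg 1 α, Real.rpow_add hn0, Real.rpow_one]
    field_simp
    ring
  have hε0 : 0 < ε := hε' ▸ Real.rpow_pos_of_pos hn0 _
  have hε1 : ε < 1 := hε' ▸ Real.rpow_lt_one_of_one_lt_of_neg hn1 (by linarith)
  have hratio : lam / n = 1 - ε := by rw [hε]; ring
  have hlam0 : 0 < lam := by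
    have h : lam = (1 - ε) * n := by rw [← hratio]; field_simp
    rw [h]
    exact mul_pos (by linarith) hn0
  set θ := ε / (1 + δ) with hθ
  have hθ0 : 0 < θ := by positivity
  have hθε : θ ≤ ε := div_le_self hε0.le (by linarith)
  have hgap : ε - θ = ε * (δ / (1 + δ)) := by rw [hθ]; field_simp; ring
  have hgap0 : 0 < ε - θ := by rw [hgap]; positivity
  set r := (1 - ε) * Real.exp θ with hr
  have hr0 : 0 ≤ r := mul_nonneg (by linarith) (Real.exp_pos _).le
  have hr1 : r ≤ 1 - ε + θ := one_sub_mul_exp_le hθε hε1 hθ0.le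
  set p := c * (lam ^ n / (Nat.factorial n : ℝ)) with hp
  have hp0 : 0 < p := by positivity
  have hν_tail (k : ℕ) : ν (k + n) = p * (1 - ε) ^ k := by
    rcases Nat.eq_zero_or_pos k with rfl | hk
    · rw [zero_add, hν1 n le_rfl, hp]; ring
    · rw [hν2 (k + n) (by omega), hratio, Nat.add_sub_cancel]
  have hν0 : ∀ q < n, 0 ≤ ν q := fun q hq => by rw [hν1 q hq.le]; positivity
  set f : ℕ → ℝ := fun q => ν q * Real.exp (ε * ((q : ℝ) - n) / (1 + δ)) with hf
  have hf_tail (k : ℕ) : f (k + n) = p * r ^ k := by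
    have h : ε * (((k + n : ℕ) : ℝ) - n) / (1 + δ) = k * θ := by
      rw [hθ]; push_cast; ring
    simp only [hf]
    rw [hν_tail, h, Real.exp_nat_mul, hr, mul_pow, mul_assoc]
  have hν_hasSum : HasSum (fun k => ν (k + n)) (p * ε⁻¹) := by
    simp only [hν_tail]
    simpa using (hasSum_geometric_of_lt_one (by linarith) (by linarith : 1 - ε < 1)).mul_left p
  have hf_hasSum : HasSum (fun k => f (k + n)) (p * (1 - r)⁻¹) := by
    simp only [hf_tail]
    exact (hasSum_geometric_of_lt_one hr0 (by linarith)).mul_left p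
  have hν_split := ((summable_nat_add_iff n).1 hν_hasSum.summable).sum_add_tsum_nat_add n
  have hf_split := ((summable_nat_add_iff n).1 hf_hasSum.summable).sum_add_tsum_nat_add n
  rw [hν_hasSum.tsum_eq, hνsum] at hν_split
  rw [hf_hasSum.tsum_eq] at hf_split
  have hδ1 : 1 ≤ 1 + 1 / δ := by
    have : 0 < 1 / δ := by positivity
    linarith
  have hhead : ∑ q ∈ Finset.range n, f q ≤ (1 + 1 / δ) * ∑ q ∈ Finset.range n, ν q := by
    rw [Finset.mul_sum]
    refine Finset.sum_le_sum fun q hq => ?_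
    have hqn := Finset.mem_range.1 hq
    have hexp : Real.exp (ε * ((q : ℝ) - n) / (1 + δ)) ≤ 1 := by
      refine Real.exp_le_one_iff.2 (div_nonpos_of_nonpos_of_nonneg ?_ (by linarith))
      refine mul_nonpos_of_nonneg_of_nonpos hε0.le ?_
      have : (q : ℝ) < n := by exact_mod_cast hqn
      linarith
    calc f q ≤ ν q * (1 + 1 / δ) := mul_le_mul_of_nonneg_left (hexp.trans hδ1) (hν0 q hqn)
      _ = (1 + 1 / δ) * ν q := mul_comm _ _
  have htail : p * (1 - r)⁻¹ ≤ (1 + 1 / δ) * (p * ε⁻¹) := by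
    calc p * (1 - r)⁻¹ ≤ p * (ε - θ)⁻¹ :=
        mul_le_mul_of_nonneg_left (inv_anti₀ hgap0 (by linarith)) hp0.le
      _ = (1 + 1 / δ) * (p * ε⁻¹) := by rw [hgap]; field_simp; ring
  rw [← hf_split]
  calc _ ≤ (1 + 1 / δ) * (∑ q ∈ Finset.range n, ν q + p * ε⁻¹) := by
        rw [mul_add]; exact add_le_add hhead htail
    _ = 1 + 1 / δ := by rw [hν_split, mul_one]
end
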